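/- arXiv:0709.2255 — 3 statements merged into one kernel-verified Lean document; each statement's English description precedes it below -/
import Mathlib

section
/- Let 1 < p < ∞. Then for every f ∈ C_c^∞(ℝ; ℂ) and every x ≠ 0 the principal value defining (Kf)(x) exists and the second integral converges absolutely, and there exists a constant C > 0, independent of f, such that ‖Kf‖_{L_p(ℝ)} ≤ C ‖f‖_{L_p(ℝ)} for all f ∈ C_c^∞(ℝ; ℂ). -/
open MeasureTheory Filter Set
open scoped ENNReal NNReal

/-- The truncated integrals whose principal value limit gives `p.v.∫ f(y)/(x-y) dy`. -/
noncomputable def cauchyTrunc (f : ℝ → ℂ) (x ε : ℝ) : ℂ :=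
  ∫ y in {y : ℝ | ε < |y - x|}, (((x - y)⁻¹ : ℝ)) • f y

/-- The double layer potential type operator
`Kf(x) = sgn(x)(1/π) p.v.∫ f(y)/(x-y) dy - (1/π)∫ f(y)/(|x|+|y|) dy`. -/
noncomputable def doubleLayer (f : ℝ → ℂ) (x : ℝ) : ℂ :=
  (Real.sign x / Real.pi) • limUnder (nhdsWithin (0 : ℝ) (Ioi 0)) (cauchyTrunc f x)
    - (1 / Real.pi) • ∫ y : ℝ, (((|x| + |y|)⁻¹ : ℝ)) • f y


/-- Pointwise trigonometric inequality behind the Riesz theorem. -/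
lemma dl_trig (p : ℝ) (hp : 1 < p) (hp2 : p ≤ 2) :
    ∃ A B : ℝ, 0 < A ∧ 0 < B ∧ ∀ z : ℂ, 0 < z.re →
      |z.im| ^ p ≤ A * z.re ^ p - B * (z ^ (p : ℂ)).re := by
  have hpi := Real.pi_pos
  set θ₀ : ℝ := (Real.pi / 4) * ((p + 1) / p) with hθ
  have hθp : θ₀ * p = (Real.pi / 4) * (p + 1) := by rw [hθ]; field_simp
  have hθ1 : θ₀ < Real.pi / 2 := by
    have : (p + 1) / p < 2 := by rw [div_lt_iff₀ (by linarith)]; linarith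
    rw [hθ]; nlinarith
  have hθ0 : 0 < θ₀ := by rw [hθ]; positivity
  have hc0 : 0 < Real.cos θ₀ := Real.cos_pos_of_mem_Ioo ⟨by linarith, hθ1⟩
  have hc1 : 0 < -Real.cos (θ₀ * p) := by
    rw [neg_pos]
    apply Real.cos_neg_of_pi_div_two_lt_of_lt <;> rw [hθp] <;> nlinarith
  set c := -Real.cos (θ₀ * p) with hc
  refine ⟨(1 + 1 / c) / (Real.cos θ₀) ^ p, 1 / c, by positivity, by positivity, ?_⟩
  intro z hz
  have hz0 : z ≠ 0 := by rintro rfl; simp at hz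
  have hn : 0 < ‖z‖ := norm_pos_iff.2 hz0
  set t := |z.arg| with ht
  have hre : z.re = ‖z‖ * Real.cos t := by
    rw [ht, Real.cos_abs, Complex.norm_mul_cos_arg]
  have hpow : (z ^ (p : ℂ)).re = ‖z‖ ^ p * Real.cos (t * p) := by
    have : Real.cos (t * p) = Real.cos (z.arg * p) := by
      rw [ht, ← Real.cos_abs (z.arg * p), abs_mul, abs_of_pos (by linarith : 0 < p)]
    rw [Complex.cpow_ofReal, this]
    simp [Complex.mul_re, -Complex.ofReal_cos, -Complex.ofReal_sin]
  have him : |z.im| ^ p ≤ ‖z‖ ^ p :=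
    Real.rpow_le_rpow (abs_nonneg _) (Complex.abs_im_le_norm z) (by linarith)
  have ht0 : 0 ≤ t := abs_nonneg _
  have ht2 : t ≤ Real.pi / 2 := Complex.abs_arg_le_pi_div_two_iff.2 hz.le
  have hct : 0 ≤ Real.cos t := Real.cos_nonneg_of_mem_Icc ⟨by linarith, ht2⟩
  rw [hre, Real.mul_rpow hn.le hct, hpow]
  have hnp : 0 < ‖z‖ ^ p := by positivity
  have key : 1 ≤ (1 + 1 / c) / (Real.cos θ₀) ^ p * (Real.cos t) ^ p
      - 1 / c * Real.cos (t * p) := by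
    rcases le_total t θ₀ with h | h
    · have h1 : Real.cos θ₀ ^ p ≤ Real.cos t ^ p :=
        Real.rpow_le_rpow hc0.le
          (Real.cos_le_cos_of_nonneg_of_le_pi ht0 (by linarith) h) (by linarith)
      have h2 : (1 + 1 / c) ≤ (1 + 1 / c) / (Real.cos θ₀) ^ p * (Real.cos t) ^ p := by
        rw [div_mul_eq_mul_div, le_div_iff₀ (by positivity)]
        exact mul_le_mul_of_nonneg_left h1 (by positivity)
      have h3 : 1 / c * Real.cos (t * p) ≤ 1 / c * 1 :=
        mul_le_mul_of_nonneg_left (Real.cos_le_one _) (by positivity)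
      linarith
    · have h1 : Real.cos (t * p) ≤ Real.cos (θ₀ * p) := by
        apply Real.cos_le_cos_of_nonneg_of_le_pi (by positivity) (by nlinarith)
        exact mul_le_mul_of_nonneg_right h (by linarith)
      have h3 : 1 / c * Real.cos (t * p) ≤ 1 / c * (-c) :=
        mul_le_mul_of_nonneg_left (by rw [hc]; linarith) (by positivity)
      have h4 : 1 / c * (-c) = -1 := by field_simp
      have h5 : 0 ≤ (1 + 1 / c) / (Real.cos θ₀) ^ p * (Real.cos t) ^ p := by positivity
      linarith
  nlinarith [mul_le_mul_of_nonneg_left key hnp.le]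

open ProbabilityTheory in
/-- The Poisson kernel is a contraction on `L^p`. -/
lemma dl_poisson (p : ℝ) (hp : 1 < p) (γ : ℝ≥0) (hγ : γ ≠ 0) (F : ℝ → ℝ≥0∞) (hF : Measurable F) :
    ∫⁻ x, (∫⁻ y, cauchyPDF x γ y * F y) ^ p ≤ ∫⁻ x, F x ^ p := by
  have hm2 : Measurable (fun z : ℝ × ℝ => cauchyPDF z.1 γ z.2) := by
    unfold cauchyPDF cauchyPDFReal; fun_prop
  have hsymm : ∀ x y, cauchyPDF x γ y = cauchyPDF y γ x := by
    intro x y; unfold cauchyPDF cauchyPDFReal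
    rw [show (y - x) ^ 2 = (x - y) ^ 2 by ring]
  have h1 : ∀ x, (∫⁻ y, cauchyPDF x γ y * F y) ^ p ≤ ∫⁻ y, cauchyPDF x γ y * F y ^ p := by
    intro x
    have hpq := Real.HolderConjugate.conjExponent hp
    have := ENNReal.lintegral_mul_le_Lp_mul_Lq (cauchyMeasure x γ) hpq
      (f := F) (g := fun _ => 1) hF.aemeasurable aemeasurable_const
    simp only [ENNReal.one_rpow, lintegral_one, measure_univ, mul_one, Pi.mul_apply] at this
    rw [cauchyMeasure_of_scale_ne_zero x hγ,
      lintegral_withDensity_eq_lintegral_mul _ (measurable_cauchyPDF x γ) hF,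
      lintegral_withDensity_eq_lintegral_mul _ (measurable_cauchyPDF x γ) (hF.pow_const p)] at this
    calc _ ≤ ((∫⁻ y, cauchyPDF x γ y * F y ^ p) ^ (1 / p)) ^ p :=
          ENNReal.rpow_le_rpow this (by linarith)
      _ = _ := by
          rw [← ENNReal.rpow_mul, one_div_mul_cancel (by linarith), ENNReal.rpow_one]
  calc _ ≤ ∫⁻ x, ∫⁻ y, cauchyPDF x γ y * F y ^ p := lintegral_mono h1
    _ = ∫⁻ y, ∫⁻ x, cauchyPDF x γ y * F y ^ p := by
        apply lintegral_lintegral_swap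
        exact (hm2.mul ((hF.comp measurable_snd).pow_const p)).aemeasurable
    _ = ∫⁻ y, F y ^ p := by
        congr 1; ext y
        simp_rw [hsymm _ y]
        rw [lintegral_mul_const _ (measurable_cauchyPDF y γ), lintegral_cauchyPDF_eq_one y hγ,
          one_mul]

/-- Vanishing of the horizontal integral of a decaying holomorphic function. -/
lemma dl_contour (G : ℂ → ℂ) (p : ℝ) (hp : 1 < p) (D R0 ε : ℝ) (hε : 0 < ε) (hD : 0 ≤ D)
    (hG : DifferentiableOn ℂ G {z | 0 < z.im})
    (hb : ∀ z : ℂ, 0 < z.im → R0 ≤ ‖z‖ → ‖G z‖ ≤ D * ‖z‖ ^ (-p)) :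
    Tendsto (fun R : ℝ => ∫ x in (-R)..R, G (x + ε * Complex.I)) atTop (nhds 0) := by
  have hlim : Tendsto (fun R : ℝ => 4 * D * R ^ (-(p - 1))) atTop (nhds 0) := by
    simpa using (tendsto_rpow_neg_atTop (by linarith : 0 < p - 1)).const_mul (4 * D)
  refine squeeze_zero_norm' ?_ hlim
  filter_upwards [eventually_ge_atTop R0, eventually_gt_atTop 0] with R hR hR0
  have key : ∀ z : ℂ, 0 < z.im → R ≤ ‖z‖ → ‖G z‖ ≤ D * R ^ (-p) := by
    intro z hz hz2
    refine (hb z hz (hR.trans hz2)).trans (mul_le_mul_of_nonneg_left ?_ hD)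
    exact Real.rpow_le_rpow_of_nonpos hR0 hz2 (by linarith)
  have hrect := Complex.integral_boundary_rect_eq_zero_of_differentiableOn G
    (⟨-R, ε⟩ : ℂ) (⟨R, ε + R⟩ : ℂ) (hG.mono (by
      intro z hz
      have := hz.2
      simp only [mem_preimage] at this
      rw [uIcc_of_le (by linarith)] at this
      exact lt_of_lt_of_le hε this.1))
  simp only at hrect
  have e1 : ‖∫ x in (-R)..R, G (x + ((ε + R : ℝ) : ℂ) * Complex.I)‖
      ≤ (D * R ^ (-p)) * |R - -R| := by
    apply intervalIntegral.norm_integral_le_of_norm_le_const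
    intro x _
    apply key
    · simp; linarith
    · refine le_trans ?_ (Complex.abs_im_le_norm _)
      simp only [Complex.add_im, Complex.ofReal_im, Complex.mul_im, Complex.I_im, Complex.I_re,
        Complex.ofReal_re]
      rw [abs_of_pos] <;> linarith
  have e2 : ∀ s : ℝ, |s| = R → ‖∫ y in ε..(ε + R), G (s + y * Complex.I)‖
      ≤ (D * R ^ (-p)) * |ε + R - ε| := by
    intro s hs
    apply intervalIntegral.norm_integral_le_of_norm_le_const
    intro x hx
    rw [uIoc_of_le (by linarith)] at hx
    apply key
    · simp; linarith [hx.1]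
    · refine le_trans ?_ (Complex.abs_re_le_norm _)
      simp [hs]
  have e3 := e2 R (abs_of_pos hR0)
  have e4 := e2 (-R) (by rw [abs_neg, abs_of_pos hR0])
  have e5 : (∫ x in (-R)..R, G (x + ε * Complex.I)) =
      (∫ x in (-R)..R, G (x + ((ε + R : ℝ) : ℂ) * Complex.I))
      - Complex.I • (∫ y in ε..(ε + R), G ((R : ℝ) + y * Complex.I))
      + Complex.I • (∫ y in ε..(ε + R), G (((-R : ℝ) : ℂ) + y * Complex.I)) := by
    linear_combination hrect
  rw [e5]
  have hpow : R ^ (-(p - 1)) = R ^ (-p) * R := by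
    rw [show -(p - 1) = -p + 1 by ring, Real.rpow_add_one hR0.ne']
  refine (norm_add_le _ _).trans ((add_le_add (norm_sub_le _ _) le_rfl).trans ?_)
  rw [norm_smul, norm_smul, Complex.norm_I, one_mul, one_mul, hpow]
  rw [show R - -R = 2 * R by ring, abs_of_pos (by linarith)] at e1
  rw [show ε + R - ε = R by ring, abs_of_pos hR0] at e3 e4
  linarith

/-- Bounded measurable functions vanishing outside a bounded set. -/
def DLBcs {E : Type*} [NormedAddCommGroup E] (f : ℝ → E) : Prop :=
  StronglyMeasurable f ∧ (∃ M : ℝ, ∀ x, ‖f x‖ ≤ M) ∧ (∃ R : ℝ, 0 < R ∧ ∀ x, R < |x| → f x = 0)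

lemma DLBcs.integrable {E : Type*} [NormedAddCommGroup E] {f : ℝ → E} (hf : DLBcs f) :
    Integrable f := by
  obtain ⟨h1, ⟨M, hM⟩, R, hR, hR2⟩ := hf
  have : IntegrableOn f (Icc (-R) R) :=
    Measure.integrableOn_of_bounded (M := M) (by simp) h1.aestronglyMeasurable
      (Eventually.of_forall hM)
  rw [← integrableOn_univ]
  refine this.of_forall_sdiff_eq_zero MeasurableSet.univ ?_
  intro x hx
  apply hR2
  by_contra h
  exact hx.2 (abs_le.1 (not_lt.1 h))

/-- Multiplication of a bounded compactly supported function by a bounded kernel. -/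
lemma DLBcs.integrable_smul {E : Type*} [NormedAddCommGroup E] [NormedSpace ℝ E]
    {f : ℝ → E} (hf : DLBcs f) (k : ℝ → ℝ) (hk : Measurable k) (c : ℝ) (hc : ∀ x, |k x| ≤ c) :
    Integrable (fun y => k y • f y) := by
  exact hf.integrable.bdd_smul c hk.aestronglyMeasurable (Eventually.of_forall hc)

noncomputable def dlKer (ε t : ℝ) : ℝ := t / (t ^ 2 + ε ^ 2)

lemma dlKer_meas (ε : ℝ) : Measurable (dlKer ε) := by unfold dlKer; fun_prop

lemma dlKer_bound (ε t : ℝ) (hε : 0 < ε) : |dlKer ε t| ≤ 1 / ε := by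
  unfold dlKer
  have h0 : 0 < t ^ 2 + ε ^ 2 := by positivity
  rw [abs_div, abs_of_pos h0, div_le_div_iff₀ h0 hε]
  nlinarith [sq_abs t, sq_nonneg (|t| - ε), abs_nonneg t]

/-- Smoothly truncated Hilbert transform (without the factor `1/π`). -/
noncomputable def dlQ {E : Type*} [NormedAddCommGroup E] [NormedSpace ℝ E]
    (ε : ℝ) (f : ℝ → E) (x : ℝ) : E := ∫ y, dlKer ε (x - y) • f y

lemma dlQ_integrable {E : Type*} [NormedAddCommGroup E] [NormedSpace ℝ E]
    {f : ℝ → E} (hf : DLBcs f) (ε : ℝ) (hε : 0 < ε) (x : ℝ) :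
    Integrable (fun y => dlKer ε (x - y) • f y) :=
  hf.integrable_smul (fun y => dlKer ε (x - y)) ((dlKer_meas ε).comp (by fun_prop)) (1 / ε)
    (fun y => dlKer_bound ε (x - y) hε)

lemma dlQ_meas {E : Type*} [NormedAddCommGroup E] [NormedSpace ℝ E]
    {f : ℝ → E} (hf : DLBcs f) (ε : ℝ) :
    StronglyMeasurable (dlQ ε f) := by
  unfold dlQ
  have h : StronglyMeasurable (fun z : ℝ × ℝ => dlKer ε (z.1 - z.2) • f z.2) := by
    apply StronglyMeasurable.smul
    · exact ((dlKer_meas ε).comp (by fun_prop : Measurable fun z : ℝ × ℝ => z.1 - z.2)).stronglyMeasurable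
    · exact hf.1.comp_measurable measurable_snd
  exact h.integral_prod_right

lemma dlQ_bound {E : Type*} [NormedAddCommGroup E] [NormedSpace ℝ E]
    {f : ℝ → E} (hf : DLBcs f) (ε : ℝ) (hε : 0 < ε) :
    ∃ M : ℝ, ∀ x, ‖dlQ ε f x‖ ≤ M := by
  refine ⟨∫ y, (1 / ε) * ‖f y‖, fun x => ?_⟩
  unfold dlQ
  apply norm_integral_le_of_norm_le (hf.integrable.norm.const_mul _)
  refine Eventually.of_forall fun y => ?_
  rw [norm_smul]
  exact mul_le_mul_of_nonneg_right (dlKer_bound ε (x - y) hε) (norm_nonneg _)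

/-- Analytic extension to the upper half plane. -/
noncomputable def dlF (f : ℝ → ℝ) (z : ℂ) : ℂ := ∫ y : ℝ, Complex.I * (z - y)⁻¹ * (f y : ℂ)

lemma dl_sub_norm (z : ℂ) (y : ℝ) : |z.im| ≤ ‖z - y‖ := by
  simpa using Complex.abs_im_le_norm (z - y)

lemma dl_sub_ne (z : ℂ) (hz : 0 < z.im) (y : ℝ) : z - y ≠ 0 := by
  intro h
  have := dl_sub_norm z y
  rw [h, norm_zero, abs_of_pos hz] at this
  linarith

lemma dlF_meas {f : ℝ → ℝ} (hf : DLBcs f) (z : ℂ) :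
    AEStronglyMeasurable (fun y : ℝ => Complex.I * (z - y)⁻¹ * (f y : ℂ)) volume := by
  have := hf.1.measurable
  exact Measurable.aestronglyMeasurable (by fun_prop)

lemma dlF_integrable {f : ℝ → ℝ} (hf : DLBcs f) (z : ℂ) (hz : 0 < z.im) :
    Integrable (fun y : ℝ => Complex.I * (z - y)⁻¹ * (f y : ℂ)) := by
  refine (hf.integrable.norm.const_mul (z.im)⁻¹).mono' (dlF_meas hf z)
    (Eventually.of_forall fun y => ?_)
  rw [norm_mul, norm_mul, Complex.norm_I, one_mul, norm_inv, Complex.norm_real]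
  apply mul_le_mul_of_nonneg_right _ (norm_nonneg _)
  have := dl_sub_norm z y
  rw [abs_of_pos hz] at this
  exact inv_anti₀ hz this

lemma dlF_re {f : ℝ → ℝ} (hf : DLBcs f) (x ε : ℝ) (hε : 0 < ε) :
    (dlF f (x + ε * Complex.I)).re = ∫ y, ε / ((x - y) ^ 2 + ε ^ 2) * f y := by
  have h := dlF_integrable hf (x + ε * Complex.I) (by simpa using hε)
  unfold dlF
  have := integral_re h
  simp only [RCLike.re_to_complex] at this
  rw [← this]
  congr 1; ext y
  rw [Complex.re_mul_ofReal]
  congr 1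
  simp [Complex.inv_re, Complex.inv_im, Complex.normSq_apply]
  ring

lemma dlF_im {f : ℝ → ℝ} (hf : DLBcs f) (x ε : ℝ) (hε : 0 < ε) :
    (dlF f (x + ε * Complex.I)).im = dlQ ε f x := by
  have h := dlF_integrable hf (x + ε * Complex.I) (by simpa using hε)
  unfold dlF dlQ dlKer
  have := integral_im h
  simp only [RCLike.im_to_complex] at this
  rw [← this]
  congr 1; ext y
  rw [Complex.im_mul_ofReal, smul_eq_mul]
  congr 1
  simp [Complex.inv_re, Complex.inv_im, Complex.normSq_apply]
  ring

lemma dlF_decay {f : ℝ → ℝ} (hf : DLBcs f) : ∃ D R0 : ℝ, 0 ≤ D ∧ 0 < R0 ∧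
    ∀ z : ℂ, R0 ≤ ‖z‖ → ‖dlF f z‖ ≤ D * ‖z‖⁻¹ := by
  obtain ⟨R, hR, hR2⟩ := hf.2.2
  refine ⟨2 * ∫ y, ‖f y‖, 2 * R, by positivity, by positivity, fun z hz => ?_⟩
  have hz0 : 0 < ‖z‖ := by linarith
  have : (2 * ∫ y, ‖f y‖) * ‖z‖⁻¹ = ∫ y, (2 * ‖z‖⁻¹) * ‖f y‖ := by
    rw [integral_const_mul]; ring
  rw [this]
  unfold dlF
  apply norm_integral_le_of_norm_le (hf.integrable.norm.const_mul _)
  refine Eventually.of_forall fun y => ?_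
  rw [norm_mul, norm_mul, Complex.norm_I, one_mul, norm_inv, Complex.norm_real]
  by_cases hy : R < |y|
  · simp [hR2 y hy]
  · apply mul_le_mul_of_nonneg_right _ (norm_nonneg _)
    have h1 : ‖z‖ - ‖(y : ℂ)‖ ≤ ‖z - y‖ := norm_sub_norm_le _ _
    rw [Complex.norm_real, Real.norm_eq_abs] at h1
    have h2 : ‖z‖ / 2 ≤ ‖z - y‖ := by linarith
    calc ‖z - y‖⁻¹ ≤ (‖z‖ / 2)⁻¹ := inv_anti₀ (by positivity) h2
      _ = 2 * ‖z‖⁻¹ := by field_simp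

lemma dlF_diff {f : ℝ → ℝ} (hf : DLBcs f) : DifferentiableOn ℂ (dlF f) {z | 0 < z.im} := by
  intro z hz
  apply DifferentiableAt.differentiableWithinAt
  have hz' : 0 < z.im := hz
  have hs : {w : ℂ | z.im / 2 < w.im} ∈ nhds z :=
    (isOpen_lt continuous_const Complex.continuous_im).mem_nhds (by simp; linarith)
  have hm := hf.1.measurable
  have := hasDerivAt_integral_of_dominated_loc_of_deriv_le (μ := volume) (𝕜 := ℂ)
    (F := fun (w : ℂ) (y : ℝ) => Complex.I * (w - y)⁻¹ * (f y : ℂ))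
    (F' := fun (w : ℂ) (y : ℝ) => Complex.I * (-1 / (w - y) ^ 2) * (f y : ℂ))
    (bound := fun y => ((z.im / 2) ^ 2)⁻¹ * ‖f y‖)
    hs (Eventually.of_forall fun w => dlF_meas hf w) (dlF_integrable hf z hz')
    (Measurable.aestronglyMeasurable (by fun_prop))
    (Eventually.of_forall fun y w hw => ?_) (hf.integrable.norm.const_mul _)
    (Eventually.of_forall fun y w hw => ?_)
  · exact this.2.differentiableAt
  · have hw' : z.im / 2 < w.im := hw
    rw [norm_mul, norm_mul, Complex.norm_I, one_mul, norm_div, norm_neg, norm_one, norm_pow,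
      Complex.norm_real, one_div]
    apply mul_le_mul_of_nonneg_right _ (norm_nonneg _)
    have := dl_sub_norm w y
    rw [abs_of_pos (by linarith)] at this
    apply inv_anti₀ (by positivity)
    exact pow_le_pow_left₀ (by linarith) (by linarith) 2
  · have hw' : z.im / 2 < w.im := hw
    have h1 : HasDerivAt (fun w : ℂ => w - y) 1 w := (hasDerivAt_id w).sub_const _
    exact ((h1.inv (dl_sub_ne w (by linarith) y)).const_mul _).mul_const _

lemma dlF_re_pos {f : ℝ → ℝ} (hf : DLBcs f) (h0 : ∀ x, 0 ≤ f x) (hi : 0 < ∫ x, f x) (z : ℂ)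
    (hz : 0 < z.im) : 0 < (dlF f z).re := by
  have hz2 : z = (z.re : ℂ) + (z.im : ℂ) * Complex.I := (Complex.re_add_im z).symm
  rw [hz2, dlF_re hf _ _ hz]
  have hpos : ∀ y : ℝ, 0 < z.im / ((z.re - y) ^ 2 + z.im ^ 2) := fun y => by positivity
  have hintg : Integrable (fun y => z.im / ((z.re - y) ^ 2 + z.im ^ 2) * f y) := by
    refine hf.integrable_smul (fun y => z.im / ((z.re - y) ^ 2 + z.im ^ 2)) (by fun_prop)
      (1 / z.im) (fun y => ?_)
    rw [abs_of_pos (hpos y), div_le_div_iff₀ (by positivity) hz]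
    nlinarith [sq_nonneg (z.re - y)]
  rw [integral_pos_iff_support_of_nonneg (fun y => mul_nonneg (hpos y).le (h0 y)) hintg]
  rw [integral_pos_iff_support_of_nonneg h0 hf.integrable] at hi
  convert hi using 2
  ext y
  rw [Function.mem_support, Function.mem_support, mul_ne_zero_iff]
  exact ⟨fun h => h.2, fun h => ⟨(hpos y).ne', h⟩⟩

open ProbabilityTheory in
lemma dlF_re_lp {f : ℝ → ℝ} (hf : DLBcs f) (p : ℝ) (hp : 1 < p) (ε : ℝ) (hε : 0 < ε) :
    ∫⁻ x : ℝ, ‖(dlF f (x + ε * Complex.I)).re‖ₑ ^ p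
      ≤ ENNReal.ofReal Real.pi ^ p * ∫⁻ x, ‖f x‖ₑ ^ p := by
  set γ : ℝ≥0 := ⟨ε, hε.le⟩ with hγ
  have hγ0 : γ ≠ 0 := by
    intro h
    have : (γ : ℝ) = 0 := by rw [h]; rfl
    exact hε.ne' this
  have hγε : (γ : ℝ) = ε := rfl
  have hm := hf.1.measurable
  have h1 : ∀ x : ℝ, ‖(dlF f (x + ε * Complex.I)).re‖ₑ
      ≤ ENNReal.ofReal Real.pi * ∫⁻ y, cauchyPDF x γ y * ‖f y‖ₑ := by
    intro x
    rw [dlF_re hf x ε hε, ← lintegral_const_mul _ (by fun_prop)]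
    refine (enorm_integral_le_lintegral_enorm _).trans (lintegral_mono fun y => le_of_eq ?_)
    rw [enorm_mul, ← mul_assoc]
    congr 1
    rw [cauchyPDF, ← ENNReal.ofReal_mul Real.pi_pos.le, Real.enorm_eq_ofReal (by positivity),
      cauchyPDFReal_def, hγε]
    congr 1
    have := Real.pi_pos
    rw [show (y - x) ^ 2 = (x - y) ^ 2 by ring]
    field_simp
  calc _ ≤ ∫⁻ x : ℝ, ENNReal.ofReal Real.pi ^ p * (∫⁻ y, cauchyPDF x γ y * ‖f y‖ₑ) ^ p := by
        refine lintegral_mono fun x => ?_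
        rw [← ENNReal.mul_rpow_of_nonneg _ _ (by linarith)]
        exact ENNReal.rpow_le_rpow (h1 x) (by linarith)
    _ = ENNReal.ofReal Real.pi ^ p * ∫⁻ x : ℝ, (∫⁻ y, cauchyPDF x γ y * ‖f y‖ₑ) ^ p := by
        rw [lintegral_const_mul']
        exact ENNReal.rpow_ne_top_of_nonneg (by linarith) ENNReal.ofReal_ne_top
    _ ≤ _ := by
        refine mul_le_mul_right ?_ _
        exact dl_poisson p hp γ hγ0 (fun y => ‖f y‖ₑ) (by fun_prop)

/-- the Riesz inequality for nonnegative functions, `1 < p ≤ 2`. -/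
lemma dl_pos (p : ℝ) (hp : 1 < p) (hp2 : p ≤ 2) :
    ∃ C : ℝ, 0 < C ∧ ∀ (ε : ℝ), 0 < ε → ∀ f : ℝ → ℝ, DLBcs f → (∀ x, 0 ≤ f x) →
      ∫⁻ x, ‖dlQ ε f x‖ₑ ^ p ≤ ENNReal.ofReal C * ∫⁻ x, ‖f x‖ₑ ^ p := by
  obtain ⟨A, B, hA, hB, hAB⟩ := dl_trig p hp hp2
  have hp0 : 0 < p := by linarith
  refine ⟨A * Real.pi ^ p, by have := Real.pi_pos; positivity, fun ε hε f hf h0 => ?_⟩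
  have hnn : 0 ≤ ∫ x, f x := integral_nonneg (fun x => h0 x)
  rcases hnn.eq_or_lt' with hi | hi
  · have hz : f =ᵐ[volume] 0 := (integral_eq_zero_iff_of_nonneg h0 hf.integrable).1 hi
    have : ∀ x, dlQ ε f x = 0 := by
      intro x
      unfold dlQ
      apply integral_eq_zero_of_ae
      filter_upwards [hz] with y hy
      simp [hy]
    simp [this, hp0]
  have hpos := dlF_re_pos hf h0 hi
  set F : ℝ → ℂ := fun x => dlF f (x + ε * Complex.I) with hF
  have hline : ∀ x : ℝ, 0 < ((x : ℂ) + ε * Complex.I).im := fun x => by simpa using hε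
  have hFc : Continuous F := by
    rw [continuous_iff_continuousAt]
    intro x
    have h1 : ContinuousAt (dlF f) ((x : ℂ) + ε * Complex.I) :=
      ((dlF_diff hf).differentiableAt ((isOpen_lt continuous_const Complex.continuous_im).mem_nhds
        (hline x))).continuousAt
    exact ContinuousAt.comp (f := fun x : ℝ => (x : ℂ) + ε * Complex.I) h1 (by fun_prop)
  have hFpos : ∀ x, 0 < (F x).re := fun x => hpos _ (hline x)
  have hFim : ∀ x, (F x).im = dlQ ε f x := fun x => dlF_im hf x ε hε
  have hQc : Continuous (dlQ ε f) := by
    have : dlQ ε f = fun x => (F x).im := by ext x; exact (hFim x).symm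
    rw [this]; exact Complex.continuous_im.comp hFc
  have hFp : Continuous (fun x => (F x) ^ (p : ℂ)) :=
    hFc.cpow continuous_const (fun x => Or.inl (hFpos x))
  have hFpre : Continuous (fun x => ((F x) ^ (p : ℂ)).re) := Complex.continuous_re.comp hFp
  -- the contour integral
  obtain ⟨D, R0, hD, hR0, hdec⟩ := dlF_decay hf
  have hcont : Tendsto (fun R : ℝ => ∫ x in (-R)..R, (F x) ^ (p : ℂ)) atTop (nhds 0) := by
    refine dl_contour (fun z => (dlF f z) ^ (p : ℂ)) p hp (D ^ p) R0 ε hε (by positivity) ?_ ?_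
    · intro z hz
      exact (dlF_diff hf z hz).cpow_const (Or.inl (hpos z hz))
    · intro z hz hz2
      have hz0 : 0 < ‖z‖ := by linarith
      rw [Complex.cpow_ofReal]
      have : ‖(Real.cos ((dlF f z).arg * p) : ℂ) + Real.sin ((dlF f z).arg * p) * Complex.I‖ = 1 := by
        rw [Complex.ofReal_cos, Complex.ofReal_sin, ← Complex.exp_mul_I,
          Complex.norm_exp_ofReal_mul_I]
      rw [norm_mul, this, mul_one, Complex.norm_real, Real.norm_eq_abs,
        abs_of_nonneg (by positivity)]
      calc ‖dlF f z‖ ^ p ≤ (D * ‖z‖⁻¹) ^ p :=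
            Real.rpow_le_rpow (norm_nonneg _) (hdec z hz2) hp0.le
        _ = D ^ p * ‖z‖ ^ (-p) := by
            rw [Real.mul_rpow hD (by positivity), Real.inv_rpow hz0.le, Real.rpow_neg hz0.le]
  set X : ℝ≥0∞ := ∫⁻ x, ‖(F x).re‖ₑ ^ p with hX
  have hXle : X ≤ ENNReal.ofReal Real.pi ^ p * ∫⁻ x, ‖f x‖ₑ ^ p := dlF_re_lp hf p hp ε hε
  have hofr : ∀ t : ℝ, ‖t‖ₑ ^ p = ENNReal.ofReal (|t| ^ p) := by
    intro t
    rw [← ENNReal.ofReal_rpow_of_nonneg (abs_nonneg _) hp0.le, ← Real.norm_eq_abs,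
      ofReal_norm]
  have hc1 : Continuous fun x => |dlQ ε f x| ^ p :=
    hQc.abs.rpow_const (fun _ => Or.inr hp0.le)
  have hc2 : Continuous fun x => |(F x).re| ^ p :=
    (Complex.continuous_re.comp hFc).abs.rpow_const (fun _ => Or.inr hp0.le)
  have hfin : ∀ R : ℝ, 0 < R → ∫⁻ x in Ioc (-R) R, ‖dlQ ε f x‖ₑ ^ p
      ≤ ENNReal.ofReal A * X + ENNReal.ofReal (B * ‖∫ x in (-R)..R, (F x) ^ (p : ℂ)‖) := by
    intro R hR
    have hle : -R ≤ R := by linarith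
    have hconv : ∀ g : ℝ → ℝ, Continuous g → (∀ x, 0 ≤ g x) →
        ENNReal.ofReal (∫ x in (-R)..R, g x) = ∫⁻ x in Ioc (-R) R, ENNReal.ofReal (g x) := by
      intro g hg hg0
      rw [intervalIntegral.integral_of_le hle, ofReal_integral_eq_lintegral_ofReal]
      · exact (hg.intervalIntegrable (-R) R).1
      · exact Eventually.of_forall hg0
    have hre : (∫ x in (-R)..R, ((F x) ^ (p : ℂ)).re) = (∫ x in (-R)..R, (F x) ^ (p : ℂ)).re := by
      have := Complex.reCLM.intervalIntegral_comp_comm (hFp.intervalIntegrable (μ := volume) (-R) R)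
      simpa using this
    have hineq : (∫ x in (-R)..R, |dlQ ε f x| ^ p)
        ≤ A * (∫ x in (-R)..R, |(F x).re| ^ p) + B * ‖∫ x in (-R)..R, (F x) ^ (p : ℂ)‖ := by
      have h1 : (∫ x in (-R)..R, |dlQ ε f x| ^ p)
          ≤ ∫ x in (-R)..R, (A * |(F x).re| ^ p - B * ((F x) ^ (p : ℂ)).re) := by
        apply intervalIntegral.integral_mono_on hle (hc1.intervalIntegrable _ _)
        · exact ((hc2.const_mul A).sub
            (hFpre.const_mul B)).intervalIntegrable _ _
        · intro x _
          rw [← hFim, abs_of_pos (hFpos x)]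
          exact hAB _ (hFpos x)
      rw [intervalIntegral.integral_sub ((hc2.const_mul A).intervalIntegrable _ _)
        ((hFpre.const_mul B).intervalIntegrable _ _),
        intervalIntegral.integral_const_mul, intervalIntegral.integral_const_mul] at h1
      rw [hre] at h1
      have h2 := Complex.abs_re_le_norm (∫ x in (-R)..R, (F x) ^ (p : ℂ))
      have h3 := neg_abs_le (∫ x in (-R)..R, (F x) ^ (p : ℂ)).re
      nlinarith
    simp_rw [hofr]
    rw [← hconv _ hc1 (fun x => by positivity)]
    refine (ENNReal.ofReal_le_ofReal hineq).trans (ENNReal.ofReal_add_le.trans ?_)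
    gcongr
    rw [ENNReal.ofReal_mul hA.le, hconv _ hc2 (fun x => by positivity)]
    gcongr
    rw [hX]
    simp_rw [hofr]
    exact setLIntegral_le_lintegral _ _
  have hlim1 : Tendsto (fun R : ℝ => ∫⁻ x in Ioc (-R) R, ‖dlQ ε f x‖ₑ ^ p) atTop
      (nhds (∫⁻ x, ‖dlQ ε f x‖ₑ ^ p)) := by
    refine (aecover_Ioc (μ := volume) tendsto_neg_atTop_atBot
      tendsto_id).lintegral_tendsto_of_countably_generated ?_
    have := hQc.measurable
    exact Measurable.aemeasurable (by fun_prop)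
  have hlim2 : Tendsto (fun R : ℝ => ENNReal.ofReal A * X +
      ENNReal.ofReal (B * ‖∫ x in (-R)..R, (F x) ^ (p : ℂ)‖)) atTop
      (nhds (ENNReal.ofReal A * X + ENNReal.ofReal (B * ‖(0 : ℂ)‖))) :=
    tendsto_const_nhds.add (ENNReal.tendsto_ofReal (hcont.norm.const_mul B))
  have hfinal := le_of_tendsto_of_tendsto hlim1 hlim2
    ((eventually_gt_atTop 0).mono hfin)
  simp only [norm_zero, mul_zero, ENNReal.ofReal_zero, add_zero] at hfinal
  refine hfinal.trans ?_
  rw [ENNReal.ofReal_mul hA.le, mul_assoc, ← ENNReal.ofReal_rpow_of_pos Real.pi_pos]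
  gcongr

lemma dl_lp_convert {E : Type*} [NormedAddCommGroup E] (p : ℝ) (hp : 1 < p) (f : ℝ → E) :
    eLpNorm f (ENNReal.ofReal p) volume = (∫⁻ x, ‖f x‖ₑ ^ p) ^ (1 / p) := by
  rw [eLpNorm_eq_lintegral_rpow_enorm_toReal (by simp; linarith) (by simp),
    ENNReal.toReal_ofReal (by linarith)]

lemma dlQ_sub {f g : ℝ → ℝ} (hf : DLBcs f) (hg : DLBcs g) (ε : ℝ) (hε : 0 < ε) :
    dlQ ε (f - g) = dlQ ε f - dlQ ε g := by
  ext x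
  simp only [dlQ, Pi.sub_apply, smul_sub]
  exact integral_sub (dlQ_integrable hf ε hε x) (dlQ_integrable hg ε hε x)

lemma DLBcs.of_le {E E' : Type*} [NormedAddCommGroup E] [NormedAddCommGroup E'] {f : ℝ → E}
    {g : ℝ → E'}
    (hf : DLBcs f) (hg : StronglyMeasurable g) (h : ∀ x, ‖g x‖ ≤ ‖f x‖) : DLBcs g := by
  obtain ⟨_, ⟨M, hM⟩, R, hR, hR2⟩ := hf
  refine ⟨hg, ⟨M, fun x => (h x).trans (hM x)⟩, R, hR, fun x hx => ?_⟩
  have := h x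
  rw [hR2 x hx, norm_zero] at this
  exact norm_le_zero_iff.1 this

/-- `L^p` bound for real functions, `1 < p ≤ 2`. -/
lemma dl_le_two (p : ℝ) (hp : 1 < p) (hp2 : p ≤ 2) :
    ∃ C : ℝ, 0 < C ∧ ∀ (ε : ℝ), 0 < ε → ∀ f : ℝ → ℝ, DLBcs f →
      eLpNorm (dlQ ε f) (ENNReal.ofReal p) volume
        ≤ ENNReal.ofReal C * eLpNorm f (ENNReal.ofReal p) volume := by
  obtain ⟨C, hC, h⟩ := dl_pos p hp hp2
  have hp0 : 0 < p := by linarith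
  have hp1 : 1 ≤ ENNReal.ofReal p := by
    rw [ENNReal.one_le_ofReal]; exact hp.le
  have hpos : ∀ (ε : ℝ), 0 < ε → ∀ f : ℝ → ℝ, DLBcs f → (∀ x, 0 ≤ f x) →
      eLpNorm (dlQ ε f) (ENNReal.ofReal p) volume
        ≤ ENNReal.ofReal (C ^ (1 / p)) * eLpNorm f (ENNReal.ofReal p) volume := by
    intro ε hε f hf h0
    rw [dl_lp_convert p hp, dl_lp_convert p hp, ← ENNReal.ofReal_rpow_of_pos hC,
      ← ENNReal.mul_rpow_of_nonneg _ _ (by positivity)]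
    exact ENNReal.rpow_le_rpow (h ε hε f hf h0) (by positivity)
  refine ⟨2 * C ^ (1 / p), by positivity, fun ε hε f hf => ?_⟩
  set f1 : ℝ → ℝ := fun x => max (f x) 0 with hf1
  set f2 : ℝ → ℝ := fun x => max (-f x) 0 with hf2
  have hm := hf.1.measurable
  have n1 : ∀ x, ‖f1 x‖ ≤ ‖f x‖ := fun x => by
    rw [Real.norm_eq_abs, Real.norm_eq_abs, abs_of_nonneg (le_max_right _ _)]
    exact max_le (le_abs_self _) (abs_nonneg _)
  have n2 : ∀ x, ‖f2 x‖ ≤ ‖f x‖ := fun x => by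
    rw [Real.norm_eq_abs, Real.norm_eq_abs, abs_of_nonneg (le_max_right _ _)]
    exact max_le (neg_le_abs _) (abs_nonneg _)
  have b1 : DLBcs f1 := hf.of_le (Measurable.stronglyMeasurable (by fun_prop)) n1
  have b2 : DLBcs f2 := hf.of_le (Measurable.stronglyMeasurable (by fun_prop)) n2
  have hd : f = f1 - f2 := by
    ext x
    simp only [hf1, hf2, Pi.sub_apply]
    rcases le_total (f x) 0 with h | h
    · rw [max_eq_right h, max_eq_left (by linarith)]; ring
    · rw [max_eq_left h, max_eq_right (by linarith)]; ring
  have hQ : dlQ ε f = dlQ ε f1 - dlQ ε f2 := by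
    conv_lhs => rw [hd]
    exact dlQ_sub b1 b2 ε hε
  rw [hQ]
  refine (eLpNorm_sub_le (dlQ_meas b1 ε).aestronglyMeasurable
    (dlQ_meas b2 ε).aestronglyMeasurable hp1).trans ?_
  have e1 := (hpos ε hε f1 b1 (fun x => le_max_right _ _)).trans
    (mul_le_mul_right (eLpNorm_mono n1) _)
  have e2 := (hpos ε hε f2 b2 (fun x => le_max_right _ _)).trans
    (mul_le_mul_right (eLpNorm_mono n2) _)
  refine (add_le_add e1 e2).trans (le_of_eq ?_)
  rw [ENNReal.ofReal_mul (by norm_num), ENNReal.ofReal_ofNat]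
  ring

/-- Antisymmetry. -/
lemma dlQ_antisymm {f g : ℝ → ℝ} (hf : DLBcs f) (hg : DLBcs g) (ε : ℝ) (hε : 0 < ε) :
    ∫ x, dlQ ε f x * g x = - ∫ y, f y * dlQ ε g y := by
  have hm := hf.1.measurable
  have hn := hg.1.measurable
  have hk := dlKer_meas ε
  have hintg : Integrable (Function.uncurry fun x y => dlKer ε (x - y) * f y * g x)
      (volume.prod volume) := by
    have h1 : Integrable (fun z : ℝ × ℝ => g z.1 * f z.2) (volume.prod volume) :=
      hg.integrable.mul_prod hf.integrable
    have h2 := h1.bdd_mul (c := 1 / ε) (f := fun z : ℝ × ℝ => dlKer ε (z.1 - z.2))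
      (Measurable.aestronglyMeasurable (by fun_prop))
      (Eventually.of_forall fun z => dlKer_bound ε _ hε)
    refine h2.congr (Eventually.of_forall fun z => ?_)
    simp only [Function.uncurry]
    ring
  calc ∫ x, dlQ ε f x * g x = ∫ x, ∫ y, dlKer ε (x - y) * f y * g x := by
        congr 1; ext x
        rw [integral_mul_const]
        rfl
    _ = ∫ y, ∫ x, dlKer ε (x - y) * f y * g x := integral_integral_swap hintg
    _ = ∫ y, -(f y * dlQ ε g y) := by
        congr 1; ext y
        rw [dlQ, ← integral_const_mul, ← integral_neg]
        congr 1; ext x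
        simp only [dlKer, smul_eq_mul]
        rw [show (y - x) ^ 2 = (x - y) ^ 2 by ring]
        ring
    _ = _ := integral_neg _

/-- `L^p` bound for real functions, `2 ≤ p`, by duality. -/
lemma dl_ge_two (p : ℝ) (hp2 : 2 ≤ p) :
    ∃ C : ℝ, 0 < C ∧ ∀ (ε : ℝ), 0 < ε → ∀ f : ℝ → ℝ, DLBcs f →
      eLpNorm (dlQ ε f) (ENNReal.ofReal p) volume
        ≤ ENNReal.ofReal C * eLpNorm f (ENNReal.ofReal p) volume := by
  have hp : 1 < p := by linarith
  have hp0 : 0 < p := by linarith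
  have hpq := Real.HolderConjugate.conjExponent hp
  set q := Real.conjExponent p with hq
  have hqdef : q = p / (p - 1) := rfl
  have hq1 : 1 < q := hpq.symm.lt
  have hq0 : 0 < q := by linarith
  have hq2 : q ≤ 2 := by
    rw [hqdef, div_le_iff₀ (by linarith)]; linarith
  have hpq1 : (p - 1) * q = p := by rw [hqdef]; field_simp [show p - 1 ≠ 0 by linarith]
  obtain ⟨C, hC, hQ⟩ := dl_le_two q hq1 hq2
  refine ⟨C, hC, fun ε hε f hf => ?_⟩
  set h := dlQ ε f with hh
  have hhm : Measurable h := (dlQ_meas hf ε).measurable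
  obtain ⟨M, hM⟩ := dlQ_bound hf ε hε
  have hM' : ∀ x, |h x| ≤ M := hM
  have hM0 : 0 ≤ M := (abs_nonneg _).trans (hM' 0)
  set N : ℝ≥0∞ := eLpNorm f (ENNReal.ofReal p) volume with hN
  have hmain : ∀ n : ℝ, 0 < n → ∫⁻ x in Ioc (-n) n, ‖h x‖ₑ ^ p ≤ (ENNReal.ofReal C * N) ^ p := by
    intro n hn
    set X : ℝ≥0∞ := ∫⁻ x in Ioc (-n) n, ‖h x‖ₑ ^ p with hX
    have hXtop : X ≠ ∞ := by
      refine ne_top_of_le_ne_top ?_ (setLIntegral_mono measurable_const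
        (g := fun _ => ENNReal.ofReal M ^ p) (fun x _ => ?_))
      · rw [setLIntegral_const]
        exact ENNReal.mul_ne_top (ENNReal.rpow_ne_top_of_nonneg hp0.le ENNReal.ofReal_ne_top)
          (by simp)
      · refine ENNReal.rpow_le_rpow ?_ hp0.le
        rw [← ofReal_norm]
        exact ENNReal.ofReal_le_ofReal (hM x)
    set g : ℝ → ℝ := (Ioc (-n) n).indicator (fun x => SignType.sign (h x) * |h x| ^ (p - 1)) with hg
    have hsgn : Measurable (fun x => ((SignType.sign (h x) : SignType) : ℝ)) := by
      have : (fun x => ((SignType.sign (h x) : SignType) : ℝ)) = fun x => Real.sign (h x) := by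
        ext x
        rcases lt_trichotomy (h x) 0 with h | h | h
        · simp [h, Real.sign_of_neg]
        · simp [h]
        · simp [h, Real.sign_of_pos]
      rw [this]
      have : Measurable Real.sign := by
        unfold Real.sign
        exact Measurable.ite measurableSet_Iio measurable_const
          (Measurable.ite measurableSet_Ioi measurable_const measurable_const)
      exact this.comp hhm
    have hgabs : ∀ x, |((SignType.sign (h x) : SignType) : ℝ) * |h x| ^ (p - 1)| = |h x| ^ (p - 1) := by
      intro x
      rw [abs_mul, abs_of_nonneg (a := |h x| ^ (p - 1)) (by positivity)]
      rcases lt_trichotomy (h x) 0 with h | h | h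
      · simp [h]
      · simp [h, Real.zero_rpow (show p - 1 ≠ 0 by linarith)]
      · simp [h]
    have hgm : Measurable g := by
      apply Measurable.indicator _ measurableSet_Ioc
      exact hsgn.mul (by fun_prop)
    have hgb : DLBcs g := by
      refine ⟨hgm.stronglyMeasurable, ⟨M ^ (p - 1), fun x => ?_⟩, n, hn, fun x hx => ?_⟩
      · rw [hg]
        refine (norm_indicator_le_norm_self _ x).trans ?_
        rw [Real.norm_eq_abs, hgabs]
        exact Real.rpow_le_rpow (abs_nonneg _) (hM' x) (by linarith)
      · apply indicator_of_notMem
        intro hx2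
        exact absurd (abs_le.2 ⟨hx2.1.le, hx2.2⟩) (not_le.2 hx)
    have hgq : eLpNorm g (ENNReal.ofReal q) volume = X ^ (1 / q) := by
      rw [dl_lp_convert q hq1, hX, ← lintegral_indicator measurableSet_Ioc]
      congr 2
      ext x
      by_cases hx : x ∈ Ioc (-n) n
      · rw [hg, indicator_of_mem hx, indicator_of_mem hx, ← ofReal_norm, ← ofReal_norm,
          Real.norm_eq_abs, Real.norm_eq_abs, hgabs,
          ENNReal.ofReal_rpow_of_nonneg (by positivity) hq0.le,
          ENNReal.ofReal_rpow_of_nonneg (by positivity) hp0.le, ← Real.rpow_mul (abs_nonneg _),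
          hpq1]
      · rw [hg, indicator_of_notMem hx, indicator_of_notMem hx, enorm_zero,
          ENNReal.zero_rpow_of_pos hq0]
    have hhg : ∀ x, h x * g x = (Ioc (-n) n).indicator (fun x => |h x| ^ p) x := by
      intro x
      by_cases hx : x ∈ Ioc (-n) n
      · rw [hg, indicator_of_mem hx, indicator_of_mem hx, ← mul_assoc, self_mul_sign]
        rcases eq_or_ne (h x) 0 with h0 | h0
        · simp [h0, Real.zero_rpow hp0.ne']
        · rw [mul_comm, ← Real.rpow_add_one (abs_pos.2 h0).ne']
          congr 1; ring
      · rw [hg, indicator_of_notMem hx, indicator_of_notMem hx, mul_zero]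
    have hXle : X ≤ ENNReal.ofReal C * N * X ^ (1 / q) := by
      have e1 : X = ‖∫ x, h x * g x‖ₑ := by
        have : (∫ x, h x * g x) = ∫ x in Ioc (-n) n, |h x| ^ p := by
          rw [← integral_indicator measurableSet_Ioc]
          congr 1; ext x; exact hhg x
        rw [this, Real.enorm_eq_ofReal (integral_nonneg fun x => by positivity),
          ofReal_integral_eq_lintegral_ofReal]
        · rw [hX]; congr 1; ext x
          rw [← ENNReal.ofReal_rpow_of_nonneg (abs_nonneg _) hp0.le, ← Real.norm_eq_abs,
            ofReal_norm]
        · refine Measure.integrableOn_of_bounded (M := M ^ p) (by simp)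
            (Measurable.aestronglyMeasurable (by fun_prop)) (Eventually.of_forall fun x => ?_)
          rw [Real.norm_eq_abs, abs_of_nonneg (by positivity)]
          exact Real.rpow_le_rpow (abs_nonneg _) (hM' x) hp0.le
        · exact Eventually.of_forall fun x => by positivity
      have e2 : ‖∫ x, h x * g x‖ₑ ≤ ∫⁻ y, ‖f y‖ₑ * ‖dlQ ε g y‖ₑ := by
        rw [hh, dlQ_antisymm hf hgb ε hε, enorm_neg]
        refine (enorm_integral_le_lintegral_enorm _).trans (le_of_eq ?_)
        congr 1; ext y; exact enorm_mul _ _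
      have e3 : ∫⁻ y, ‖f y‖ₑ * ‖dlQ ε g y‖ₑ
          ≤ N * eLpNorm (dlQ ε g) (ENNReal.ofReal q) volume := by
        rw [hN, dl_lp_convert p hp, dl_lp_convert q hq1]
        have m1 := hf.1.measurable
        have m2 := (dlQ_meas hgb ε).measurable
        exact ENNReal.lintegral_mul_le_Lp_mul_Lq volume hpq (f := fun y => ‖f y‖ₑ)
          (g := fun y => ‖dlQ ε g y‖ₑ) m1.enorm.aemeasurable m2.enorm.aemeasurable
      calc X ≤ N * eLpNorm (dlQ ε g) (ENNReal.ofReal q) volume := by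
            rw [e1]; exact e2.trans e3
        _ ≤ N * (ENNReal.ofReal C * X ^ (1 / q)) := by
            rw [← hgq]
            exact mul_le_mul_right (hQ ε hε g hgb) _
        _ = _ := by ring
    rcases eq_or_ne X 0 with hX0 | hX0
    · rw [hX0]; exact zero_le
    have hXq0 : X ^ (1 / q) ≠ 0 := by
      intro h0
      rw [ENNReal.rpow_eq_zero_iff] at h0
      rcases h0 with h0 | h0
      · exact hX0 h0.1
      · exact hXtop h0.1
    have hXqt : X ^ (1 / q) ≠ ∞ := ENNReal.rpow_ne_top_of_nonneg (by positivity) hXtop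
    have hsplit : X = X ^ (1 / p) * X ^ (1 / q) := by
      rw [← ENNReal.rpow_add _ _ hX0 hXtop]
      have : 1 / p + 1 / q = 1 := by
        have := hpq.inv_add_inv_eq_one
        simpa [one_div] using this
      rw [this, ENNReal.rpow_one]
    have : X ^ (1 / p) ≤ ENNReal.ofReal C * N := by
      have h2 : X ^ (1 / p) * X ^ (1 / q) ≤ ENNReal.ofReal C * N * X ^ (1 / q) := by
        rw [← hsplit]; exact hXle
      exact (ENNReal.mul_le_mul_iff_left hXq0 hXqt).1 h2
    calc X = (X ^ (1 / p)) ^ p := by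
          rw [← ENNReal.rpow_mul, one_div_mul_cancel hp0.ne', ENNReal.rpow_one]
      _ ≤ _ := ENNReal.rpow_le_rpow this hp0.le
  have hlim1 : Tendsto (fun R : ℝ => ∫⁻ x in Ioc (-R) R, ‖h x‖ₑ ^ p) atTop
      (nhds (∫⁻ x, ‖h x‖ₑ ^ p)) := by
    refine (aecover_Ioc (μ := volume) tendsto_neg_atTop_atBot
      tendsto_id).lintegral_tendsto_of_countably_generated ?_
    exact Measurable.aemeasurable (by fun_prop)
  have hfin := le_of_tendsto hlim1 ((eventually_gt_atTop 0).mono hmain)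
  rw [dl_lp_convert p hp]
  calc _ ≤ ((ENNReal.ofReal C * N) ^ p) ^ (1 / p) := ENNReal.rpow_le_rpow hfin (by positivity)
    _ = _ := by rw [← ENNReal.rpow_mul, mul_one_div_cancel hp0.ne', ENNReal.rpow_one]

lemma dl_real (p : ℝ) (hp : 1 < p) :
    ∃ C : ℝ, 0 < C ∧ ∀ (ε : ℝ), 0 < ε → ∀ f : ℝ → ℝ, DLBcs f →
      eLpNorm (dlQ ε f) (ENNReal.ofReal p) volume
        ≤ ENNReal.ofReal C * eLpNorm f (ENNReal.ofReal p) volume := by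
  rcases le_total p 2 with h | h
  · exact dl_le_two p hp h
  · exact dl_ge_two p h

/-- `L^p` bound for the truncated operators on complex functions. -/
lemma dl_complex (p : ℝ) (hp : 1 < p) :
    ∃ C : ℝ, 0 < C ∧ ∀ (ε : ℝ), 0 < ε → ∀ f : ℝ → ℂ, DLBcs f →
      eLpNorm (dlQ ε f) (ENNReal.ofReal p) volume
        ≤ ENNReal.ofReal C * eLpNorm f (ENNReal.ofReal p) volume := by
  obtain ⟨C, hC, h⟩ := dl_real p hp
  have hp1 : 1 ≤ ENNReal.ofReal p := by
    rw [ENNReal.one_le_ofReal]; exact hp.le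
  refine ⟨2 * C, by positivity, fun ε hε f hf => ?_⟩
  have hm := hf.1.measurable
  have n1 : ∀ x, ‖(f x).re‖ ≤ ‖f x‖ := fun x => Complex.abs_re_le_norm _
  have n2 : ∀ x, ‖(f x).im‖ ≤ ‖f x‖ := fun x => Complex.abs_im_le_norm _
  have b1 : DLBcs (fun x => (f x).re) :=
    hf.of_le (Measurable.stronglyMeasurable (by fun_prop)) n1
  have b2 : DLBcs (fun x => (f x).im) :=
    hf.of_le (Measurable.stronglyMeasurable (by fun_prop)) n2
  have e1 := (h ε hε _ b1).trans (mul_le_mul_right (eLpNorm_mono n1) _)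
  have e2 := (h ε hε _ b2).trans (mul_le_mul_right (eLpNorm_mono n2) _)
  have c1 : ∀ x, (dlQ ε f x).re = dlQ ε (fun x => (f x).re) x := by
    intro x
    have := integral_re (dlQ_integrable hf ε hε x)
    simp only [RCLike.re_to_complex, Complex.smul_re] at this
    exact this.symm
  have c2 : ∀ x, (dlQ ε f x).im = dlQ ε (fun x => (f x).im) x := by
    intro x
    have := integral_im (dlQ_integrable hf ε hε x)
    simp only [RCLike.im_to_complex, Complex.smul_im] at this
    exact this.symm
  have step : eLpNorm (dlQ ε f) (ENNReal.ofReal p) volume ≤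
      eLpNorm ((fun x => ‖dlQ ε (fun x => (f x).re) x‖) + fun x => ‖dlQ ε (fun x => (f x).im) x‖)
        (ENNReal.ofReal p) volume := by
    apply eLpNorm_mono_real
    intro x
    rw [Pi.add_apply, ← c1, ← c2]
    exact Complex.norm_le_abs_re_add_abs_im _
  refine step.trans ((eLpNorm_add_le (dlQ_meas b1 ε).norm.aestronglyMeasurable
    (dlQ_meas b2 ε).norm.aestronglyMeasurable hp1).trans ?_)
  rw [eLpNorm_norm, eLpNorm_norm]
  refine (add_le_add e1 e2).trans (le_of_eq ?_)
  rw [ENNReal.ofReal_mul (by norm_num), ENNReal.ofReal_ofNat]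
  ring

lemma DLBcs.of_smooth {f : ℝ → ℂ} (hf : ContDiff ℝ (⊤ : ℕ∞) f) (hc : HasCompactSupport f) :
    DLBcs f := by
  refine ⟨hf.continuous.stronglyMeasurable, hc.exists_bound_of_continuous hf.continuous, ?_⟩
  obtain ⟨R, hR⟩ := hc.isCompact.isBounded.subset_closedBall (0 : ℝ)
  refine ⟨max R 1, by positivity, fun x hx => ?_⟩
  apply image_eq_zero_of_notMem_tsupport
  intro h
  have := hR h
  rw [Metric.mem_closedBall, dist_zero_right, Real.norm_eq_abs] at this
  linarith [le_max_left R 1]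

/-- The symmetrised difference quotient. -/
noncomputable def dlG (f : ℝ → ℂ) (x t : ℝ) : ℂ := t⁻¹ • (f (x - t) - f (x + t))

lemma dlG_bcs {f : ℝ → ℂ} (hf : ContDiff ℝ (⊤ : ℕ∞) f) (hc : HasCompactSupport f) (x : ℝ) :
    DLBcs (dlG f x) := by
  obtain ⟨K, hK⟩ := hf.lipschitzWith_of_hasCompactSupport hc (by simp)
  obtain ⟨_, _, R, hR, hR2⟩ := DLBcs.of_smooth hf hc
  have hm := hf.continuous.measurable
  refine ⟨?_, ⟨2 * K, fun t => ?_⟩, R + |x|, by positivity, fun t ht => ?_⟩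
  · unfold dlG
    exact Measurable.stronglyMeasurable (by fun_prop)
  · unfold dlG
    rcases eq_or_ne t 0 with rfl | h0
    · simp
    have h1 := hK.dist_le_mul (x - t) (x + t)
    rw [dist_eq_norm, dist_eq_norm, show x - t - (x + t) = -(2 * t) by ring, norm_neg, norm_mul,
      Real.norm_ofNat] at h1
    rw [norm_smul, norm_inv]
    have h2 : 0 < ‖t‖ := norm_pos_iff.2 h0
    rw [inv_mul_le_iff₀ h2]
    linarith
  · unfold dlG
    have h1 : R < |x - t| := by
      have := abs_sub_abs_le_abs_sub t x
      rw [abs_sub_comm]; linarith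
    have h2 : R < |x + t| := by
      have := abs_sub_abs_le_abs_sub t (-x)
      rw [abs_neg, sub_neg_eq_add, add_comm t x] at this; linarith
    rw [hR2 _ h1, hR2 _ h2]; simp

lemma dl_pv_limit {f : ℝ → ℂ} (hf : ContDiff ℝ (⊤ : ℕ∞) f) (hc : HasCompactSupport f) (x : ℝ)
    (k : ℝ → ℝ → ℝ) (hkm : ∀ δ, 0 < δ → Measurable (k δ))
    (hkb : ∀ δ, 0 < δ → ∃ c, ∀ t, |k δ t| ≤ c) (hodd : ∀ δ t, k δ (-t) = - k δ t)
    (h1 : ∀ δ, 0 < δ → ∀ t, |k δ t * t| ≤ 1)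
    (hlim : ∀ t, t ≠ 0 → Tendsto (fun δ => k δ t * t) (nhdsWithin 0 (Ioi 0)) (nhds 1)) :
    Tendsto (fun δ => ∫ y, k δ (x - y) • f y) (nhdsWithin 0 (Ioi 0))
      (nhds ((1 / 2 : ℝ) • ∫ t, dlG f x t)) := by
  have hb := DLBcs.of_smooth hf hc
  have hG := dlG_bcs hf hc x
  have hrepr : ∀ δ, 0 < δ → ∫ y, k δ (x - y) • f y
      = (1 / 2 : ℝ) • ∫ t, (k δ t * t) • dlG f x t := by
    intro δ hδ
    obtain ⟨c, hcb⟩ := hkb δ hδ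
    have hkm' := hkm δ hδ
    have i0 : Integrable (fun y => k δ (x - y) • f y) :=
      hb.integrable_smul (fun y => k δ (x - y)) (by fun_prop) c (fun y => hcb _)
    have i1 : Integrable (fun t => k δ t • f (x - t)) := by
      have := i0.comp_sub_left x
      simpa using this
    have i2 : Integrable (fun t => k δ t • f (x + t)) := by
      have := i1.comp_neg.neg
      refine this.congr (Eventually.of_forall fun t => ?_)
      simp [hodd]
    have s1 : ∫ y, k δ (x - y) • f y = ∫ t, k δ t • f (x - t) := by
      rw [← integral_sub_left_eq_self (fun y => k δ (x - y) • f y) volume x]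
      simp
    have s2 : ∫ t, k δ t • f (x - t) = - ∫ t, k δ t • f (x + t) := by
      rw [← integral_neg_eq_self (fun t => k δ t • f (x - t)) volume, ← integral_neg]
      congr 1; ext t
      simp [hodd]
    have s3 : ∫ t, (k δ t * t) • dlG f x t = ∫ t, (k δ t • f (x - t) - k δ t • f (x + t)) := by
      congr 1; ext t
      unfold dlG
      rcases eq_or_ne t 0 with rfl | h0
      · simp
      · rw [smul_smul, mul_assoc, mul_inv_cancel₀ h0, mul_one, smul_sub]
    rw [s3, integral_sub i1 i2, s1]
    have : ∫ t, k δ t • f (x + t) = - ∫ t, k δ t • f (x - t) := by rw [s2, neg_neg]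
    rw [this, sub_neg_eq_add, ← two_smul ℝ, smul_smul]
    norm_num
  have hdct : Tendsto (fun δ => ∫ t, (k δ t * t) • dlG f x t) (nhdsWithin 0 (Ioi 0))
      (nhds (∫ t, dlG f x t)) := by
    refine tendsto_integral_filter_of_dominated_convergence (fun t => ‖dlG f x t‖) ?_ ?_
      hG.integrable.norm ?_
    · filter_upwards [self_mem_nhdsWithin] with δ hδ
      have hk2 : Measurable (fun t => k δ t * t) := (hkm δ hδ).mul measurable_id
      exact AEStronglyMeasurable.smul hk2.aestronglyMeasurable
        hG.1.aestronglyMeasurable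
    · filter_upwards [self_mem_nhdsWithin] with δ hδ
      refine Eventually.of_forall fun t => ?_
      rw [norm_smul]
      exact mul_le_of_le_one_left (norm_nonneg _) (h1 δ hδ t)
    · refine Eventually.of_forall fun t => ?_
      rcases eq_or_ne t 0 with rfl | h0
      · simp [dlG]
      · simpa using (hlim t h0).smul_const (dlG f x t)
  refine (hdct.const_smul (1 / 2 : ℝ)).congr' ?_
  filter_upwards [self_mem_nhdsWithin] with δ hδ
  exact (hrepr δ hδ).symm

lemma dl_trunc_limit {f : ℝ → ℂ} (hf : ContDiff ℝ (⊤ : ℕ∞) f) (hc : HasCompactSupport f) (x : ℝ) :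
    Tendsto (cauchyTrunc f x) (nhdsWithin 0 (Ioi 0)) (nhds ((1 / 2 : ℝ) • ∫ t, dlG f x t)) := by
  have hset : ∀ δ : ℝ, MeasurableSet {t : ℝ | δ < |t|} := fun δ =>
    measurableSet_lt measurable_const measurable_id.abs
  have h := dl_pv_limit hf hc x (fun δ => {t : ℝ | δ < |t|}.indicator (fun t => t⁻¹))
    (fun δ _ => measurable_inv.indicator (hset δ)) ?_ ?_ ?_ ?_
  · refine h.congr fun δ => ?_
    unfold cauchyTrunc
    have hs : MeasurableSet {y : ℝ | δ < |y - x|} :=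
      measurableSet_lt measurable_const (by fun_prop)
    rw [← integral_indicator hs]
    congr 1; ext y
    simp only [indicator, mem_ofPred_eq, abs_sub_comm y x]
    split_ifs <;> simp
  · intro δ hδ
    refine ⟨1 / δ, fun t => ?_⟩
    simp only [indicator, mem_ofPred_eq]
    split_ifs with h
    · rw [abs_inv, one_div]; exact inv_anti₀ hδ h.le
    · simp; positivity
  · intro δ t
    simp only [indicator, mem_ofPred_eq, abs_neg]
    split_ifs
    · rw [inv_neg]
    · simp
  · intro δ hδ t
    simp only [indicator, mem_ofPred_eq]
    split_ifs with h
    · have : t ≠ 0 := by rintro rfl; simp at h; linarith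
      simp [this]
    · simp
  · intro t ht
    apply tendsto_const_nhds.congr'
    have : ∀ᶠ δ : ℝ in nhdsWithin 0 (Ioi 0), δ < |t| :=
      nhdsWithin_le_nhds (eventually_lt_nhds (abs_pos.2 ht))
    filter_upwards [this] with δ hδ
    simp [indicator, hδ, ht]

lemma dlKer_tendsto (t : ℝ) (ht : t ≠ 0) :
    Tendsto (fun ε => dlKer ε t) (nhdsWithin 0 (Ioi 0)) (nhds t⁻¹) := by
  have : Tendsto (fun ε => dlKer ε t) (nhds 0) (nhds (dlKer 0 t)) := by
    unfold dlKer
    apply Tendsto.div tendsto_const_nhds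
    · exact Continuous.tendsto (by fun_prop) 0
    · simpa using ht
  have h0 : dlKer 0 t = t⁻¹ := by unfold dlKer; field_simp; simp
  rw [h0] at this
  exact this.mono_left nhdsWithin_le_nhds

lemma dl_smooth_limit {f : ℝ → ℂ} (hf : ContDiff ℝ (⊤ : ℕ∞) f) (hc : HasCompactSupport f) (x : ℝ) :
    Tendsto (fun ε => dlQ ε f x) (nhdsWithin 0 (Ioi 0)) (nhds ((1 / 2 : ℝ) • ∫ t, dlG f x t)) := by
  refine dl_pv_limit hf hc x dlKer (fun δ _ => dlKer_meas δ)
    (fun δ hδ => ⟨1 / δ, fun t => dlKer_bound δ t hδ⟩) ?_ ?_ ?_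
  · intro δ t; unfold dlKer; rw [neg_sq, neg_div]
  · intro δ hδ t
    unfold dlKer
    have h0 : 0 < t ^ 2 + δ ^ 2 := by positivity
    rw [div_mul_eq_mul_div, abs_div, abs_of_pos h0, div_le_one h0, abs_of_nonneg (by nlinarith)]
    nlinarith
  · intro t ht
    simpa [ht] using (dlKer_tendsto t ht).mul_const t

lemma dl_second_integrable {f : ℝ → ℂ} (hb : DLBcs f) (x : ℝ) (hx : x ≠ 0) :
    Integrable (fun y : ℝ => (((|x| + |y|)⁻¹ : ℝ)) • f y) volume := by
  have hx' := abs_pos.2 hx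
  refine hb.integrable_smul (fun y => (|x| + |y|)⁻¹) (by fun_prop) |x|⁻¹ (fun y => ?_)
  rw [abs_of_pos (by positivity)]
  exact inv_anti₀ hx' (by linarith [abs_nonneg y])

lemma DLBcs.indicator {f : ℝ → ℂ} (hf : DLBcs f) {s : Set ℝ} (hs : MeasurableSet s) :
    DLBcs (s.indicator f) :=
  hf.of_le (hf.1.indicator hs) (fun x => norm_indicator_le_norm_self _ x)

lemma dl_second_limit {f : ℝ → ℂ} (hb : DLBcs f) (x : ℝ) (hx : x ≠ 0) :
    Tendsto (fun ε => dlQ ε ((Iic 0).indicator f) |x| - dlQ ε ((Ioi 0).indicator f) (-|x|))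
      (nhdsWithin 0 (Ioi 0)) (nhds (∫ y : ℝ, (((|x| + |y|)⁻¹ : ℝ)) • f y)) := by
  have hx' := abs_pos.2 hx
  have hrepr : ∀ ε, 0 < ε →
      dlQ ε ((Iic 0).indicator f) |x| - dlQ ε ((Ioi 0).indicator f) (-|x|)
      = ∫ y, dlKer ε (|x| + |y|) • f y := by
    intro ε hε
    unfold dlQ
    rw [← integral_sub (dlQ_integrable (hb.indicator measurableSet_Iic) ε hε _)
      (dlQ_integrable (hb.indicator measurableSet_Ioi) ε hε _)]
    congr 1; ext y
    rcases le_or_gt y 0 with h | h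
    · rw [indicator_of_mem (by exact h), indicator_of_notMem (by simpa using h), smul_zero,
        sub_zero, abs_of_nonpos h, sub_eq_add_neg]
    · rw [indicator_of_notMem (by simpa using h), indicator_of_mem (by exact h), smul_zero,
        zero_sub, abs_of_pos h, ← neg_smul]
      congr 1
      unfold dlKer
      rw [show -|x| - y = -(|x| + y) by ring, neg_sq, neg_div, neg_neg]
  have hdct : Tendsto (fun ε => ∫ y, dlKer ε (|x| + |y|) • f y) (nhdsWithin 0 (Ioi 0))
      (nhds (∫ y : ℝ, (((|x| + |y|)⁻¹ : ℝ)) • f y)) := by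
    refine tendsto_integral_filter_of_dominated_convergence
      (fun y => ‖(((|x| + |y|)⁻¹ : ℝ)) • f y‖) ?_ ?_ (dl_second_integrable hb x hx).norm ?_
    · filter_upwards with ε
      have hk2 : Measurable (fun y : ℝ => dlKer ε (|x| + |y|)) :=
        (dlKer_meas ε).comp (by fun_prop)
      exact AEStronglyMeasurable.smul hk2.aestronglyMeasurable
        hb.1.aestronglyMeasurable
    · filter_upwards [self_mem_nhdsWithin] with ε hε
      refine Eventually.of_forall fun y => ?_
      rw [norm_smul, norm_smul]
      apply mul_le_mul_of_nonneg_right _ (norm_nonneg _)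
      have hs : 0 < |x| + |y| := by positivity
      have hd : 0 < (|x| + |y|) / ((|x| + |y|) ^ 2 + ε ^ 2) := by positivity
      unfold dlKer
      rw [Real.norm_eq_abs, Real.norm_eq_abs, abs_of_pos hd,
        abs_of_pos (inv_pos.2 hs), inv_eq_one_div, div_le_div_iff₀ (by positivity) hs]
      nlinarith
    · refine Eventually.of_forall fun y => ?_
      exact (dlKer_tendsto (|x| + |y|) (by positivity)).smul_const (f y)
  refine hdct.congr' ?_
  filter_upwards [self_mem_nhdsWithin] with ε hε
  exact (hrepr ε hε).symm

/-- Regularised double layer operator. -/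
noncomputable def dlK (f : ℝ → ℂ) (ε x : ℝ) : ℂ :=
  (Real.sign x / Real.pi) • dlQ ε f x
    - (1 / Real.pi) • (dlQ ε ((Iic 0).indicator f) |x| - dlQ ε ((Ioi 0).indicator f) (-|x|))

lemma dlK_tendsto {f : ℝ → ℂ} (hf : ContDiff ℝ (⊤ : ℕ∞) f) (hc : HasCompactSupport f) (x : ℝ)
    (hx : x ≠ 0) :
    Tendsto (fun ε => dlK f ε x) (nhdsWithin 0 (Ioi 0)) (nhds (doubleLayer f x)) := by
  unfold dlK doubleLayer
  rw [(dl_trunc_limit hf hc x).limUnder_eq]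
  exact ((dl_smooth_limit hf hc x).const_smul _).sub
    ((dl_second_limit (DLBcs.of_smooth hf hc) x hx).const_smul _)

lemma dl_sign_meas : Measurable Real.sign := by
  unfold Real.sign
  exact Measurable.ite measurableSet_Iio measurable_const
    (Measurable.ite measurableSet_Ioi measurable_const measurable_const)

lemma dlK_meas {f : ℝ → ℂ} (hb : DLBcs f) (ε : ℝ) : AEStronglyMeasurable (dlK f ε) volume := by
  have m0 := (dlQ_meas hb ε).measurable
  have m1 := (dlQ_meas (hb.indicator (measurableSet_Iic (a := 0))) ε).measurable
  have m2 := (dlQ_meas (hb.indicator (measurableSet_Ioi (a := 0))) ε).measurable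
  have m3 := dl_sign_meas
  unfold dlK
  exact Measurable.aestronglyMeasurable (by fun_prop)

lemma dlK_bound (p : ℝ) (hp : 1 < p) :
    ∃ C : ℝ, 0 < C ∧ ∀ (ε : ℝ), 0 < ε → ∀ f : ℝ → ℂ, DLBcs f →
      eLpNorm (dlK f ε) (ENNReal.ofReal p) volume
        ≤ ENNReal.ofReal C * eLpNorm f (ENNReal.ofReal p) volume := by
  obtain ⟨C, hC, h⟩ := dl_complex p hp
  have hp1 : 1 ≤ ENNReal.ofReal p := by
    rw [ENNReal.one_le_ofReal]; exact hp.le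
  refine ⟨5 * C, by positivity, fun ε hε f hb => ?_⟩
  have b1 := hb.indicator (measurableSet_Iic (a := (0 : ℝ)))
  have b2 := hb.indicator (measurableSet_Ioi (a := (0 : ℝ)))
  set u0 := dlQ ε f with hu0
  set u1 := dlQ ε ((Iic 0).indicator f) with hu1
  set u2 := dlQ ε ((Ioi 0).indicator f) with hu2
  have m0 : StronglyMeasurable u0 := dlQ_meas hb ε
  have m1 : StronglyMeasurable u1 := dlQ_meas b1 ε
  have m2 : StronglyMeasurable u2 := dlQ_meas b2 ε
  set B : ℝ≥0∞ := ENNReal.ofReal C * eLpNorm f (ENNReal.ofReal p) volume with hB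
  have e0 : eLpNorm u0 (ENNReal.ofReal p) volume ≤ B := h ε hε f hb
  have e1 : eLpNorm u1 (ENNReal.ofReal p) volume ≤ B :=
    (h ε hε _ b1).trans (mul_le_mul_right (eLpNorm_indicator_le _) _)
  have e2 : eLpNorm u2 (ENNReal.ofReal p) volume ≤ B :=
    (h ε hε _ b2).trans (mul_le_mul_right (eLpNorm_indicator_le _) _)
  have mp := Measure.measurePreserving_neg (volume : Measure ℝ)
  have m1' : StronglyMeasurable (u1 ∘ Neg.neg) := m1.comp_measurable measurable_neg
  have m2' : StronglyMeasurable (u2 ∘ Neg.neg) := m2.comp_measurable measurable_neg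
  have e1' : eLpNorm (u1 ∘ Neg.neg) (ENNReal.ofReal p) volume ≤ B := by
    rw [eLpNorm_comp_measurePreserving m1.aestronglyMeasurable mp]; exact e1
  have e2' : eLpNorm (u2 ∘ Neg.neg) (ENNReal.ofReal p) volume ≤ B := by
    rw [eLpNorm_comp_measurePreserving m2.aestronglyMeasurable mp]; exact e2
  have hpi : (1 / Real.pi) ≤ 1 := by
    rw [div_le_one Real.pi_pos]; linarith [Real.pi_gt_three]
  have hpi0 : 0 < 1 / Real.pi := by have := Real.pi_pos; positivity
  have step : eLpNorm (dlK f ε) (ENNReal.ofReal p) volume ≤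
      eLpNorm ((fun x => ‖u0 x‖) + ((fun x => ‖u1 x‖) + ((fun x => ‖(u1 ∘ Neg.neg) x‖) +
        ((fun x => ‖u2 x‖) + (fun x => ‖(u2 ∘ Neg.neg) x‖)))))
        (ENNReal.ofReal p) volume := by
    apply eLpNorm_mono_real
    intro x
    simp only [Pi.add_apply, Function.comp_apply]
    unfold dlK
    rw [← hu0, ← hu1, ← hu2]
    have t1 : ‖(Real.sign x / Real.pi) • u0 x‖ ≤ ‖u0 x‖ := by
      rw [norm_smul]
      apply mul_le_of_le_one_left (norm_nonneg _)
      rw [norm_div, Real.norm_eq_abs, Real.norm_eq_abs, abs_of_pos Real.pi_pos]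
      refine le_trans ?_ hpi
      apply div_le_div_of_nonneg_right _ Real.pi_pos.le
      rcases Real.sign_apply_eq x with h | h | h <;> rw [h] <;> norm_num
    have t2 : ‖(1 / Real.pi) • (u1 |x| - u2 (-|x|))‖ ≤ ‖u1 |x|‖ + ‖u2 (-|x|)‖ := by
      rw [norm_smul]
      refine le_trans (mul_le_of_le_one_left (norm_nonneg _) ?_) (norm_sub_le _ _)
      rw [Real.norm_eq_abs, abs_of_pos hpi0]; exact hpi
    have t3 : ‖u1 |x|‖ ≤ ‖u1 x‖ + ‖u1 (-x)‖ := by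
      rcases abs_choice x with h | h <;> rw [h] <;> simp
    have t4 : ‖u2 (-|x|)‖ ≤ ‖u2 x‖ + ‖u2 (-x)‖ := by
      rcases abs_choice x with h | h <;> rw [h] <;> simp
    have := norm_sub_le ((Real.sign x / Real.pi) • u0 x) ((1 / Real.pi) • (u1 |x| - u2 (-|x|)))
    linarith
  have a0 := m0.norm.aestronglyMeasurable (μ := volume)
  have a1 := m1.norm.aestronglyMeasurable (μ := volume)
  have a2 := m2.norm.aestronglyMeasurable (μ := volume)
  have a1' := m1'.norm.aestronglyMeasurable (μ := volume)
  have a2' := m2'.norm.aestronglyMeasurable (μ := volume)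
  refine step.trans ?_
  refine (eLpNorm_add_le a0 (a1.add (a1'.add (a2.add a2'))) hp1).trans ?_
  refine (add_le_add le_rfl (eLpNorm_add_le a1 (a1'.add (a2.add a2')) hp1)).trans ?_
  refine (add_le_add le_rfl (add_le_add le_rfl (eLpNorm_add_le a1' (a2.add a2') hp1))).trans ?_
  refine (add_le_add le_rfl (add_le_add le_rfl (add_le_add le_rfl
    (eLpNorm_add_le a2 a2' hp1)))).trans ?_
  simp only [eLpNorm_norm]
  refine (add_le_add e0 (add_le_add e1 (add_le_add e1' (add_le_add e2 e2')))).trans (le_of_eq ?_)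
  rw [ENNReal.ofReal_mul (by norm_num), ENNReal.ofReal_ofNat, hB]
  ring

/-- for `1 < p < ∞`, for every `f ∈ C_c^∞(ℝ;ℂ)` and every `x ≠ 0` the
principal value defining `(Kf)(x)` exists and the second integral converges absolutely,
and there is a constant `C > 0` independent of `f` with `‖Kf‖_p ≤ C ‖f‖_p`. -/
theorem double_layer_pv_exists_and_bounded (p : ℝ) (hp : 1 < p) :
    (∀ f : ℝ → ℂ, ContDiff ℝ (⊤ : ℕ∞) f → HasCompactSupport f → ∀ x : ℝ, x ≠ 0 →
      (∃ L : ℂ, Tendsto (cauchyTrunc f x) (nhdsWithin (0 : ℝ) (Ioi 0)) (nhds L)) ∧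
      Integrable (fun y : ℝ => (((|x| + |y|)⁻¹ : ℝ)) • f y) volume) ∧
    (∃ C : ℝ, 0 < C ∧ ∀ f : ℝ → ℂ, ContDiff ℝ (⊤ : ℕ∞) f → HasCompactSupport f →
      eLpNorm (doubleLayer f) (ENNReal.ofReal p) volume
        ≤ ENNReal.ofReal C * eLpNorm f (ENNReal.ofReal p) volume) := by
  refine ⟨fun f hf hc x hx => ⟨⟨_, dl_trunc_limit hf hc x⟩,
    dl_second_integrable (DLBcs.of_smooth hf hc) x hx⟩, ?_⟩
  obtain ⟨C, hC, h⟩ := dlK_bound p hp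
  refine ⟨C, hC, fun f hf hc => ?_⟩
  have hb := DLBcs.of_smooth hf hc
  refine Lp.eLpNorm_le_of_ae_tendsto (u := nhdsWithin (0 : ℝ) (Ioi 0))
    (f := fun ε => dlK f ε) ?_ (fun ε => dlK_meas hb ε) ?_
  · filter_upwards [self_mem_nhdsWithin] with ε hε
    exact h ε hε f hb
  · have : ∀ᵐ x : ℝ, x ≠ 0 := by simp [ae_iff]
    filter_upwards [this] with x hx
    exact dlK_tendsto hf hc x hx
end

section
/- Let α ∈ (−2,1) with α ≠ −1, set k := tan(πα/2), and let β, γ ∈ ℝ, t > 0, z > 0, x ∈ ℝ. Then the principal value I := lim_{ε→0⁺} ∫_{{y > 0 : |y−z| > ε}} ( (γt + β(y−x)) / (t² + (y−x)²) ) · ( y^{1+α} / (y² − z²) ) dy exists, and (2k/π) · z^{−α} · I = ((k²−1)/2) · (γt − β(x−z)) / (t² + (x−z)²) − ((k²+1)/2) · (γt − β(x+z)) / (t² + (x+z)²) − Re( (1−ik)² (β − iγ) (x+it)^{1+α} / ((x+it)² − z²) ) · z^{−α}, where (x+it)^{1+α} denotes the principal branch of the complex power (note arg(x+it) ∈ (0,π)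 since t > 0). -/
open MeasureTheory Filter Set
open scoped ENNReal NNReal

lemma rf_lint_gamma {a r : ℝ} (ha : 0 < a) (hr : 0 < r) (C : ℝ) (hC : 0 ≤ C) :
    ∫⁻ s in Ioi (0:ℝ), ENNReal.ofReal (C * (s ^ (a - 1) * Real.exp (-(r * s))))
      = ENNReal.ofReal (C * ((1 / r) ^ a * Real.Gamma a)) := by
  have h := Real.integral_rpow_mul_exp_neg_mul_Ioi ha hr
  have hpos : 0 < (1 / r) ^ a * Real.Gamma a :=
    mul_pos (Real.rpow_pos_of_pos (by positivity) _) (Real.Gamma_pos_of_pos ha)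
  have h_integ : IntegrableOn (fun s : ℝ => s ^ (a - 1) * Real.exp (-(r * s))) (Ioi 0) := by
    by_contra hn
    have := integral_undef hn
    rw [h] at this
    exact hpos.ne' this
  rw [← ofReal_integral_eq_lintegral_ofReal (h_integ.const_mul C), integral_const_mul, h]
  refine (ae_restrict_iff' measurableSet_Ioi).2 (Eventually.of_forall fun s hs => ?_)
  have : 0 ≤ s ^ (a - 1) := Real.rpow_nonneg (le_of_lt hs) _
  simp only [Pi.zero_apply]
  positivity

lemma rf_lint {b c : ℝ} (hb : -1 < b) (hb0 : b < 0) (hc : 0 < c) :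
    ∫⁻ y in Ioi (0:ℝ), ENNReal.ofReal (y ^ b / (y + c))
      = ENNReal.ofReal (c ^ b * (Real.pi / Real.sin (Real.pi * (b + 1)))) := by
  have h1 : ∀ y ∈ Ioi (0:ℝ), ENNReal.ofReal (y ^ b / (y + c)) =
      ∫⁻ s in Ioi (0:ℝ), ENNReal.ofReal (y ^ b * Real.exp (-((y + c) * s))) := by
    intro y hy
    have hy' : (0:ℝ) < y := hy
    have := rf_lint_gamma (a := 1) (r := y + c) one_pos (by positivity) (y ^ b)
      (Real.rpow_nonneg hy'.le _)
    simp only [sub_self, Real.rpow_zero, one_mul, Real.rpow_one, Real.Gamma_one, mul_one] at this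
    rw [this, mul_one_div]
  rw [setLIntegral_congr_fun measurableSet_Ioi h1, lintegral_lintegral_swap]
  · have h2 : ∀ s ∈ Ioi (0:ℝ),
        ∫⁻ y in Ioi (0:ℝ), ENNReal.ofReal (y ^ b * Real.exp (-((y + c) * s))) =
        ENNReal.ofReal (Real.Gamma (b + 1) * (s ^ (-b - 1) * Real.exp (-(c * s)))) := by
      intro s hs
      have hs' : (0:ℝ) < s := hs
      have := rf_lint_gamma (a := b + 1) (r := s) (by linarith) hs' (Real.exp (-(c * s)))
        (Real.exp_pos _).le
      have e : (1 / s) ^ (b + 1) = s ^ (-b - 1) := by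
        rw [one_div, Real.inv_rpow hs'.le, ← Real.rpow_neg hs'.le]; congr 1; ring
      rw [e] at this
      rw [show Real.Gamma (b + 1) * (s ^ (-b - 1) * Real.exp (-(c * s))) =
        Real.exp (-(c * s)) * (s ^ (-b - 1) * Real.Gamma (b + 1)) by ring, ← this]
      refine setLIntegral_congr_fun measurableSet_Ioi fun y _ => ?_
      simp only [add_sub_cancel_right]
      rw [show -((y + c) * s) = -(c * s) + -(s * y) by ring, Real.exp_add]
      ring_nf
    rw [setLIntegral_congr_fun measurableSet_Ioi h2,
      rf_lint_gamma (a := -b) (by linarith) hc _ (Real.Gamma_pos_of_pos (by linarith)).le]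
    congr 1
    rw [← Real.Gamma_mul_Gamma_one_sub, show 1 - (b + 1) = -b by ring,
      one_div, Real.inv_rpow hc.le, ← Real.rpow_neg hc.le, neg_neg]
    ring
  · apply Measurable.aemeasurable
    fun_prop

lemma rf_sin_pos {b : ℝ} (hb : -1 < b) (hb0 : b < 0) : 0 < Real.sin (Real.pi * (b + 1)) := by
  apply Real.sin_pos_of_pos_of_lt_pi
  · have := Real.pi_pos; nlinarith
  · have := Real.pi_pos; nlinarith

lemma rf_intg {b c : ℝ} (hb : -1 < b) (hb0 : b < 0) (hc : 0 < c) :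
    IntegrableOn (fun y : ℝ => y ^ b / (y + c)) (Ioi 0) := by
  refine ⟨Measurable.aestronglyMeasurable (by fun_prop), ?_⟩
  rw [hasFiniteIntegral_iff_ofReal, rf_lint hb hb0 hc]
  · exact ENNReal.ofReal_lt_top
  refine (ae_restrict_iff' measurableSet_Ioi).2 (Eventually.of_forall fun s hs => ?_)
  have hs' : (0:ℝ) < s := hs
  have : 0 ≤ s ^ b := Real.rpow_nonneg (le_of_lt hs) _
  simp only [Pi.zero_apply]
  positivity

lemma rf_int {b c : ℝ} (hb : -1 < b) (hb0 : b < 0) (hc : 0 < c) :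
    ∫ y in Ioi (0:ℝ), y ^ b / (y + c) = c ^ b * (Real.pi / Real.sin (Real.pi * (b + 1))) := by
  rw [integral_eq_lintegral_of_nonneg_ae, rf_lint hb hb0 hc, ENNReal.toReal_ofReal]
  · have := rf_sin_pos hb hb0
    have := Real.pi_pos
    positivity
  · refine (ae_restrict_iff' measurableSet_Ioi).2 (Eventually.of_forall fun s hs => ?_)
    have hs' : (0:ℝ) < s := hs
    have : 0 ≤ s ^ b := Real.rpow_nonneg (le_of_lt hs) _
    simp only [Pi.zero_apply]
    positivity
  · exact (rf_intg hb hb0 hc).1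

lemma rf_slit {c : ℂ} (hc : c ∈ Complex.slitPlane) :
    ∃ m : ℝ, 0 < m ∧ ∀ c' ∈ Metric.ball c m, ∀ y : ℝ, 0 < y → m * (y + 1) ≤ ‖(y : ℂ) + c'‖ := by
  obtain ⟨d, hd, hd'⟩ : ∃ d : ℝ, 0 < d ∧ ∀ y : ℝ, 0 < y → d ≤ ‖(y : ℂ) + c‖ := by
    rcases hc with h | h
    · refine ⟨c.re, h, fun y hy => le_trans ?_ (Complex.re_le_norm _)⟩
      simp; exact hy.le
    · refine ⟨|c.im|, by positivity, fun y hy => le_trans ?_ (Complex.abs_im_le_norm _)⟩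
      simp
  set M : ℝ := 1 + (‖c‖ + 1) / d with hM
  have hMpos : 0 < M := by positivity
  refine ⟨1 / (2 * M), by positivity, fun c' hc' y hy => ?_⟩
  have h1 := hd' y hy
  have h2 : y ≤ ‖(y : ℂ) + c‖ + ‖c‖ := by
    have := norm_sub_le ((y : ℂ) + c) c
    simpa [abs_of_pos hy] using this
  have h3 : y + 1 ≤ ‖(y : ℂ) + c‖ * M := by
    rw [hM, mul_add, mul_one]
    have : (‖c‖ + 1) ≤ ‖(y : ℂ) + c‖ * ((‖c‖ + 1) / d) := by
      rw [← mul_div_assoc, le_div_iff₀ hd]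
      nlinarith [norm_nonneg c]
    linarith
  have h4 : ‖(y : ℂ) + c‖ ≤ ‖(y : ℂ) + c'‖ + 1 / (2 * M) := by
    rw [mem_ball_iff_norm] at hc'
    have := norm_sub_le ((y : ℂ) + c') (c' - c)
    rw [show (y : ℂ) + c' - (c' - c) = y + c by ring] at this
    linarith
  have h5 : 2 * (1 / (2 * M) * (y + 1)) ≤ ‖(y : ℂ) + c‖ := by
    rw [show 2 * (1 / (2 * M) * (y + 1)) = (y + 1) / M by field_simp, div_le_iff₀ hMpos]
    exact h3
  have h6 : 1 / (2 * M) ≤ 1 / (2 * M) * (y + 1) := by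
    have : 0 < 1 / (2 * M) := by positivity
    nlinarith
  linarith

lemma rf_cint {b : ℝ} (hb : -1 < b) (hb0 : b < 0) {c : ℂ} (hc : c ∈ Complex.slitPlane) :
    IntegrableOn (fun y : ℝ => ((y ^ b : ℝ) : ℂ) / (y + c)) (Ioi 0) := by
  obtain ⟨m, hm, h⟩ := rf_slit hc
  refine Integrable.mono' ((rf_intg hb hb0 one_pos).const_mul (1 / m))
    (Measurable.aestronglyMeasurable (by fun_prop)) ?_
  refine (ae_restrict_iff' measurableSet_Ioi).2 (Eventually.of_forall fun y hy => ?_)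
  have hy' : (0:ℝ) < y := hy
  have h0 : 0 ≤ y ^ b := Real.rpow_nonneg hy'.le _
  have := h c (Metric.mem_ball_self hm) y hy
  rw [norm_div, Complex.norm_real, Real.norm_of_nonneg h0]
  calc y ^ b / ‖(y : ℂ) + c‖ ≤ y ^ b / (m * (y + 1)) := by gcongr
    _ = _ := by field_simp

lemma rf_cdiff {b : ℝ} (hb : -1 < b) (hb0 : b < 0) :
    DifferentiableOn ℂ (fun c : ℂ => ∫ y in Ioi (0:ℝ), ((y ^ b : ℝ) : ℂ) / (y + c))
      Complex.slitPlane := by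
  intro c hc
  obtain ⟨m, hm, h⟩ := rf_slit hc
  have := hasDerivAt_integral_of_dominated_loc_of_deriv_le (𝕜 := ℂ)
    (μ := volume.restrict (Ioi (0:ℝ)))
    (F := fun (c : ℂ) (y : ℝ) => ((y ^ b : ℝ) : ℂ) / (y + c))
    (F' := fun (c : ℂ) (y : ℝ) => -((y ^ b : ℝ) : ℂ) / (y + c) ^ 2)
    (bound := fun y => 1 / m ^ 2 * (y ^ b / (y + 1)))
    (x₀ := c) (Metric.ball_mem_nhds c hm)
    (Eventually.of_forall fun c' => Measurable.aestronglyMeasurable (by fun_prop))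
    (rf_cint hb hb0 hc) (Measurable.aestronglyMeasurable (by fun_prop))
    ?_ ((rf_intg hb hb0 one_pos).const_mul _) ?_
  · exact this.2.differentiableAt.differentiableWithinAt
  · refine (ae_restrict_iff' measurableSet_Ioi).2 (Eventually.of_forall fun y hy => ?_)
    intro c' hc'
    have hy' : (0:ℝ) < y := hy
    have h0 : 0 ≤ y ^ b := Real.rpow_nonneg hy'.le _
    have := h c' hc' y hy
    rw [norm_div, norm_neg, Complex.norm_real, Real.norm_of_nonneg h0, norm_pow]
    calc y ^ b / ‖(y : ℂ) + c'‖ ^ 2 ≤ y ^ b / (m * (y + 1)) ^ 2 := by gcongr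
      _ = 1 / m ^ 2 * (y ^ b / (y + 1) ^ 2) := by field_simp
      _ ≤ _ := by
        gcongr
        nlinarith
  · refine (ae_restrict_iff' measurableSet_Ioi).2 (Eventually.of_forall fun y hy => ?_)
    intro c' hc'
    have hy' : (0:ℝ) < y := hy
    have h1 := h c' hc' y hy
    have hne : (y : ℂ) + c' ≠ 0 := by
      rw [← norm_pos_iff]
      have : 0 < m * (y + 1) := by positivity
      linarith
    have := (hasDerivAt_const c' ((y ^ b : ℝ) : ℂ)).fun_div ((hasDerivAt_id c').const_add (y : ℂ)) hne
    simpa using this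

lemma rf_G {b : ℝ} (hb : -1 < b) (hb0 : b < 0) {c : ℂ} (hc : c ∈ Complex.slitPlane) :
    ∫ y in Ioi (0:ℝ), ((y ^ b : ℝ) : ℂ) / (y + c)
      = c ^ (b : ℂ) * ((Real.pi / Real.sin (Real.pi * (b + 1)) : ℝ) : ℂ) := by
  have hA := (rf_cdiff hb hb0).analyticOnNhd Complex.isOpen_slitPlane
  have hB : AnalyticOnNhd ℂ (fun c : ℂ => c ^ (b : ℂ) *
      ((Real.pi / Real.sin (Real.pi * (b + 1)) : ℝ) : ℂ)) Complex.slitPlane := by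
    apply DifferentiableOn.analyticOnNhd _ Complex.isOpen_slitPlane
    intro c hc
    apply DifferentiableAt.differentiableWithinAt
    exact (DifferentiableAt.cpow_const (f := fun c : ℂ => c) differentiableAt_id hc).mul_const _
  refine hA.eqOn_of_preconnected_of_frequently_eq hB
    (Complex.starConvex_one_slitPlane.isPathConnected (by simp)).isConnected.isPreconnected
    (z₀ := 1) (by simp) ?_ hc
  have ht : Tendsto (fun n : ℕ => (((1 + 1 / ((n : ℝ) + 1) : ℝ)) : ℂ)) atTop
      (nhdsWithin 1 {1}ᶜ) := by
    apply tendsto_nhdsWithin_iff.2 ⟨?_, Eventually.of_forall fun n => ?_⟩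
    · have : Tendsto (fun n : ℕ => 1 + 1 / ((n : ℝ) + 1)) atTop (nhds (1 + 0)) :=
        tendsto_const_nhds.add tendsto_one_div_add_atTop_nhds_zero_nat
      rw [add_zero] at this
      exact_mod_cast (Complex.continuous_ofReal.tendsto 1).comp this
    · simp only [mem_compl_iff, mem_singleton_iff]
      have : (1 + 1 / ((n : ℝ) + 1) : ℝ) ≠ 1 := by
        have : 0 < 1 / ((n : ℝ) + 1) := by positivity
        linarith
      exact_mod_cast this
  refine ht.frequently (Eventually.of_forall fun n => ?_).frequently
  set r : ℝ := 1 + 1 / ((n : ℝ) + 1) with hr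
  have hr0 : 0 < r := by positivity
  have := rf_int hb hb0 hr0
  rw [← Complex.ofReal_cpow hr0.le, ← Complex.ofReal_mul, ← this, ← integral_complex_ofReal]
  simp

/-- The truncated half-line. -/
def rfS (z ε : ℝ) : Set ℝ := {y : ℝ | y ∈ Ioi (0 : ℝ) ∧ ε < |y - z|}

lemma rfS_meas (z ε : ℝ) : MeasurableSet (rfS z ε) :=
  measurableSet_Ioi.inter (measurableSet_lt (f := fun _ : ℝ => ε) (g := fun y : ℝ => |y - z|)
    measurable_const (by fun_prop))

lemma rfS_sub (z ε : ℝ) : rfS z ε ⊆ Ioi 0 := fun _ h => h.1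

lemma rf_trunc {h : ℝ → ℂ} (z : ℝ) (hh : IntegrableOn h (Ioi 0)) :
    Tendsto (fun ε : ℝ => ∫ y in rfS z ε, h y) (nhdsWithin 0 (Ioi 0))
      (nhds (∫ y in Ioi (0:ℝ), h y)) := by
  have e : ∀ ε : ℝ, ∫ y in rfS z ε, h y = ∫ y in Ioi (0:ℝ), (rfS z ε).indicator h y := by
    intro ε
    rw [setIntegral_indicator (rfS_meas z ε), inter_eq_self_of_subset_right (rfS_sub z ε)]
  simp_rw [e]
  refine tendsto_integral_filter_of_dominated_convergence (fun y => ‖h y‖)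
    (Eventually.of_forall fun ε => hh.1.indicator (rfS_meas z ε))
    (Eventually.of_forall fun ε => Eventually.of_forall fun y => norm_indicator_le_norm_self _ _)
    hh.norm ?_
  have hz : ∀ᵐ y ∂(volume.restrict (Ioi (0:ℝ))), y ≠ z :=
    ae_restrict_of_ae (Measure.ae_ne volume z)
  filter_upwards [hz, ae_restrict_mem measurableSet_Ioi] with y hy hy0
  apply tendsto_const_nhds.congr'
  have : 0 < |y - z| := abs_pos.2 (sub_ne_zero.2 hy)
  filter_upwards [nhdsWithin_le_nhds (Iio_mem_nhds this)] with ε hε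
  rw [indicator_of_mem]
  exact ⟨hy0, hε⟩

lemma rf_far {z ε : ℝ} (hz : 0 < z) (hε : 0 < ε) {y : ℝ} (h : ε ≤ |y - z|) :
    y + 1 ≤ (1 + (z + 1) / ε) * |y - z| := by
  have h1 : y - z ≤ |y - z| := le_abs_self _
  have h2 : z + 1 ≤ (z + 1) / ε * |y - z| := by
    rw [div_mul_eq_mul_div, le_div_iff₀ hε]; nlinarith
  linarith

lemma rf_int_trunc {g : ℝ → ℂ} {z ε : ℝ} (hz : 0 < z) (hε : 0 < ε) (hg : Measurable g)
    (hgi : IntegrableOn (fun y => g y / (y + 1)) (Ioi 0)) :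
    IntegrableOn (fun y => g y / (y - z)) (rfS z ε) := by
  refine Integrable.mono' ((hgi.mono_set (rfS_sub z ε)).norm.const_mul (1 + (z + 1) / ε))
    (Measurable.aestronglyMeasurable (by fun_prop)) ?_
  refine (ae_restrict_iff' (rfS_meas z ε)).2 (Eventually.of_forall fun y hy => ?_)
  have hy0 : 0 < y := hy.1
  have h1 := rf_far hz hε hy.2.le
  have h2 : 0 < |y - z| := hε.trans hy.2
  rw [norm_div, norm_div]
  rw [show (y : ℂ) - z = ((y - z : ℝ) : ℂ) by push_cast; rfl,
    show (y : ℂ) + 1 = ((y + 1 : ℝ) : ℂ) by push_cast; rfl, Complex.norm_real, Complex.norm_real,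
    Real.norm_eq_abs, Real.norm_of_nonneg (by positivity : 0 ≤ y + 1)]
  rw [← mul_div_assoc, div_le_div_iff₀ h2 (by positivity)]
  nlinarith [norm_nonneg (g y)]

lemma rf_int_reg {q : ℝ → ℂ} {z : ℝ} (hz : 0 < z) (hq : Measurable q)
    (hqi : IntegrableOn (fun y => q y / (y + 1)) (Ioi 0)) (hqz : q z = 0)
    (hd : DifferentiableAt ℝ q z) :
    IntegrableOn (fun y => q y / (y - z)) (Ioi 0) := by
  have hO := hd.hasDerivAt.isBigO_sub
  obtain ⟨K, hK⟩ := hO.bound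
  obtain ⟨δ, hδ, hb⟩ := Metric.eventually_nhds_iff.1 hK
  have hsub : Ioi (0:ℝ) ⊆ Metric.ball z δ ∪ rfS z (δ / 2) := by
    intro y hy
    by_cases h : |y - z| < δ
    · left; exact h
    · right; exact ⟨hy, by linarith⟩
  refine IntegrableOn.mono_set (IntegrableOn.union ?_ (rf_int_trunc hz (half_pos hδ) hq hqi)) hsub
  refine Measure.integrableOn_of_bounded (M := |K|) measure_ball_lt_top.ne
    (Measurable.aestronglyMeasurable (by fun_prop)) ?_
  refine (ae_restrict_iff' measurableSet_ball).2 (Eventually.of_forall fun y hy => ?_)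
  have := hb hy
  rw [hqz, sub_zero] at this
  rw [norm_div]
  apply div_le_of_le_mul₀ (norm_nonneg _) (abs_nonneg _)
  refine this.trans ?_
  rw [show (y : ℂ) - z = ((y - z : ℝ) : ℂ) by push_cast; rfl, Complex.norm_real]
  gcongr
  exact le_abs_self K

/-- antiderivative -/
noncomputable def rfP (z y : ℝ) : ℝ := Real.log (√y - √z) - Real.log (√y + √z)

lemma rfP_deriv {z y : ℝ} (hz : 0 < z) (hy : 0 < y) (hne : y ≠ z) :
    HasDerivAt (rfP z) (√z * (y ^ (-(1/2) : ℝ) / (y - z))) y := by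
  have hs := Real.sqrt_pos.2 hz
  have ht := Real.sqrt_pos.2 hy
  have hz2 := Real.sq_sqrt hz.le
  have hy2 := Real.sq_sqrt hy.le
  have hn : √y - √z ≠ 0 := by
    intro h
    apply hne
    rw [← hz2, ← hy2, sub_eq_zero.1 h]
  have hp : √y + √z ≠ 0 := by positivity
  have h1 := ((Real.hasDerivAt_sqrt hy.ne').sub_const (√z)).log hn
  have h2 := ((Real.hasDerivAt_sqrt hy.ne').add_const (√z)).log hp
  have := h1.sub h2
  refine this.congr_deriv ?_
  rw [Real.rpow_neg hy.le, ← Real.sqrt_eq_rpow]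
  have e : y - z = (√y - √z) * (√y + √z) := by linear_combination hz2 - hy2
  rw [e]
  field_simp
  ring

lemma rfP_tendsto (z : ℝ) : Tendsto (rfP z) atTop (nhds 0) := by
  have h0 : Tendsto (fun s : ℝ => Real.log (1 - √z / s) - Real.log (1 + √z / s)) atTop
      (nhds (Real.log (1 - 0) - Real.log (1 + 0))) := by
    have h : Tendsto (fun s : ℝ => √z / s) atTop (nhds 0) :=
      tendsto_const_nhds.div_atTop tendsto_id
    exact ((tendsto_const_nhds.sub h).log (by simp)).sub ((tendsto_const_nhds.add h).log (by simp))
  simp only [sub_zero, add_zero, sub_self] at h0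
  refine (h0.comp Real.tendsto_sqrt_atTop).congr' ?_
  filter_upwards [eventually_gt_atTop (max 0 z)] with y hy
  have hy0 : 0 < y := (le_max_left _ _).trans_lt hy
  have hyz : z < y := (le_max_right _ _).trans_lt hy
  have hs : 0 < √y := Real.sqrt_pos.2 hy0
  have hlt : √z < √y := (Real.sqrt_lt_sqrt_iff_of_pos hy0).2 hyz
  have h0 : 0 ≤ √z := Real.sqrt_nonneg z
  simp only [Function.comp, rfP]
  rw [show √y - √z = √y * (1 - √z / √y) by field_simp,
    show √y + √z = √y * (1 + √z / √y) by field_simp,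
    Real.log_mul hs.ne' (by rw [sub_ne_zero]; exact ((div_lt_one hs).2 hlt).ne'),
    Real.log_mul hs.ne' (by positivity)]
  ring

lemma rfP_left {z ε : ℝ} (hz : 0 < z) (hε : 0 < ε) (h : ε < z) :
    rfP z (z - ε) = Real.log ε - 2 * Real.log (√(z - ε) + √z) := by
  have hs := Real.sqrt_pos.2 hz
  have h1 := Real.sq_sqrt hz.le
  have h2 := Real.sq_sqrt (sub_pos.2 h).le
  have h3 := Real.sqrt_nonneg (z - ε)
  have e : √(z - ε) - √z = -(ε / (√(z - ε) + √z)) := by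
    field_simp; linear_combination h2 - h1
  rw [rfP, e, Real.log_neg_eq_log, Real.log_div hε.ne' (by positivity)]
  ring

lemma rfP_right {z ε : ℝ} (hz : 0 < z) (hε : 0 < ε) :
    rfP z (z + ε) = Real.log ε - 2 * Real.log (√(z + ε) + √z) := by
  have hs := Real.sqrt_pos.2 hz
  have h1 := Real.sq_sqrt hz.le
  have h2 := Real.sq_sqrt (add_pos hz hε).le
  have h3 := Real.sqrt_nonneg (z + ε)
  have e : √(z + ε) - √z = (ε / (√(z + ε) + √z)) := by
    field_simp; linear_combination h2 - h1
  rw [rfP, e, Real.log_div hε.ne' (by positivity)]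
  ring

lemma rfS_eq {z ε : ℝ} (hz : 0 < z) (hε : 0 < ε) :
    rfS z ε = Ioo 0 (z - ε) ∪ Ioi (z + ε) := by
  ext y
  simp only [rfS, mem_ofPred_eq, mem_Ioi, mem_union, mem_Ioo, lt_abs]
  constructor
  · rintro ⟨h, h' | h'⟩
    · right; linarith
    · left; constructor <;> linarith
  · rintro (⟨h, h'⟩ | h)
    · exact ⟨h, Or.inr (by linarith)⟩
    · exact ⟨by linarith, Or.inl (by linarith)⟩

lemma rf_half_cint : IntegrableOn (fun y : ℝ => ((y ^ (-(1/2) : ℝ) : ℝ) : ℂ) / (y + 1)) (Ioi 0) :=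
  rf_cint (by norm_num) (by norm_num) (by simp)

lemma rf_half_real {z ε : ℝ} (hz : 0 < z) (hε : 0 < ε) :
    IntegrableOn (fun y : ℝ => y ^ (-(1/2) : ℝ) / (y - z)) (rfS z ε) := by
  have := (rf_int_trunc hz hε (g := fun y : ℝ => ((y ^ (-(1/2) : ℝ) : ℝ) : ℂ)) (by fun_prop)
    rf_half_cint).re
  refine this.congr (Eventually.of_forall fun y => ?_)
  simp only [RCLike.re_to_complex]
  rw [← Complex.ofReal_sub, ← Complex.ofReal_div, Complex.ofReal_re]

lemma rf_half_val {z ε : ℝ} (hz : 0 < z) (hε : 0 < ε) (h : ε < z) :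
    √z * ∫ y in rfS z ε, y ^ (-(1/2) : ℝ) / (y - z) =
      2 * Real.log (√(z + ε) + √z) - 2 * Real.log (√(z - ε) + √z) := by
  have hi : IntegrableOn (fun y : ℝ => √z * (y ^ (-(1/2) : ℝ) / (y - z))) (rfS z ε) :=
    (rf_half_real hz hε).const_mul (√z)
  rw [← integral_const_mul]
  have hi1 := hi.mono_set (show Ioo 0 (z - ε) ⊆ rfS z ε by rw [rfS_eq hz hε]; exact subset_union_left)
  have hi2 := hi.mono_set (show Ioi (z + ε) ⊆ rfS z ε by rw [rfS_eq hz hε]; exact subset_union_right)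
  rw [rfS_eq hz hε, setIntegral_union _ measurableSet_Ioi hi1 hi2]
  · have a2 := integral_Ioi_of_hasDerivAt_of_tendsto' (a := z + ε) (f := rfP z)
      (fun y hy => rfP_deriv hz (by have := mem_Ici.1 hy; linarith)
        (by have := mem_Ici.1 hy; intro h; linarith)) hi2 (rfP_tendsto z)
    rw [a2, ← integral_Ioc_eq_integral_Ioo, ← intervalIntegral.integral_of_le (by linarith)]
    have a1 := intervalIntegral.integral_eq_sub_of_hasDerivAt_of_le (a := 0) (b := z - ε)
      (f := rfP z) (f' := fun y => √z * (y ^ (-(1/2) : ℝ) / (y - z))) (by linarith) ?_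
      (fun y hy => rfP_deriv hz hy.1 (by have := hy.2; intro h; linarith)) ?_
    · rw [a1, rfP_left hz hε h, rfP_right hz hε]
      simp [rfP]
    · intro y hy
      have hlt : √y < √z := Real.sqrt_lt_sqrt hy.1 (by linarith [hy.2])
      have h0 := Real.sqrt_nonneg y
      apply ContinuousAt.continuousWithinAt
      unfold rfP
      exact ((Real.continuous_sqrt.continuousAt.sub continuousAt_const).log
        (sub_ne_zero.2 hlt.ne)).sub
        ((Real.continuous_sqrt.continuousAt.add continuousAt_const).log
          (by change √y + √z ≠ 0; linarith))
    · rw [intervalIntegrable_iff_integrableOn_Ioo_of_le (by linarith)]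
      exact hi1
  · rw [Set.disjoint_left]
    intro y h1 h2
    have := h1.2
    have := mem_Ioi.1 h2
    linarith

lemma rf_half_tendsto {z : ℝ} (hz : 0 < z) :
    Tendsto (fun ε : ℝ => ∫ y in rfS z ε, ((y ^ (-(1/2) : ℝ) : ℝ) : ℂ) / (y - z))
      (nhdsWithin 0 (Ioi 0)) (nhds 0) := by
  have hs := Real.sqrt_pos.2 hz
  have h1 : Tendsto (fun ε : ℝ => (√z)⁻¹ * (2 * Real.log (√(z + ε) + √z) -
      2 * Real.log (√(z - ε) + √z))) (nhdsWithin 0 (Ioi 0)) (nhds 0) := by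
    have : ContinuousAt (fun ε : ℝ => (√z)⁻¹ * (2 * Real.log (√(z + ε) + √z) -
      2 * Real.log (√(z - ε) + √z))) 0 := by
      refine continuousAt_const.mul (ContinuousAt.sub ?_ ?_)
      · refine continuousAt_const.mul (ContinuousAt.log (by fun_prop) (by simp; positivity))
      · refine continuousAt_const.mul (ContinuousAt.log (by fun_prop) (by simp; positivity))
    have h := this.tendsto
    simp only [add_zero, sub_zero, sub_self, mul_zero] at h
    exact h.mono_left nhdsWithin_le_nhds
  have h2 := (Complex.continuous_ofReal.tendsto 0).comp h1
  rw [Complex.ofReal_zero] at h2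
  refine h2.congr' ?_
  filter_upwards [self_mem_nhdsWithin, nhdsWithin_le_nhds (Iio_mem_nhds hz)] with ε hε hεz
  simp only [Function.comp]
  rw [← rf_half_val hz hε hεz, ← mul_assoc, inv_mul_cancel₀ hs.ne', one_mul,
    ← integral_complex_ofReal]
  simp

/-- principal value by regularisation -/
lemma rf_pv {g : ℝ → ℂ} {z : ℝ} (hz : 0 < z) (hg : Measurable g)
    (hgi : IntegrableOn (fun y => g y / (y + 1)) (Ioi 0)) (hd : DifferentiableAt ℝ g z) :
    IntegrableOn (fun y : ℝ => (g y - g z * √z * ((y ^ (-(1/2) : ℝ) : ℝ) : ℂ)) / (y - z)) (Ioi 0) ∧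
    Tendsto (fun ε : ℝ => ∫ y in rfS z ε, g y / (y - z)) (nhdsWithin 0 (Ioi 0))
      (nhds (∫ y in Ioi (0:ℝ), (g y - g z * √z * ((y ^ (-(1/2) : ℝ) : ℝ) : ℂ)) / (y - z))) := by
  have hs := Real.sqrt_pos.2 hz
  have hi : IntegrableOn (fun y : ℝ =>
      (g y - g z * √z * ((y ^ (-(1/2) : ℝ) : ℝ) : ℂ)) / (y - z)) (Ioi 0) := by
    apply rf_int_reg (q := fun y : ℝ => g y - g z * √z * ((y ^ (-(1/2) : ℝ) : ℝ) : ℂ)) hz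
      (by fun_prop)
    · refine (hgi.sub (rf_half_cint.const_mul (g z * √z))).congr
        (Eventually.of_forall fun y => ?_)
      simp only [Pi.sub_apply]
      ring
    · rw [mul_assoc, ← Complex.ofReal_mul, Real.rpow_neg hz.le, ← Real.sqrt_eq_rpow,
        mul_inv_cancel₀ hs.ne']
      simp
    · refine hd.sub (DifferentiableAt.const_mul ?_ _)
      have := (Real.hasDerivAt_rpow_const (x := z) (p := -(1/2)) (Or.inl hz.ne')).ofReal_comp
      exact this.differentiableAt
  refine ⟨hi, ?_⟩
  have h := (rf_trunc z hi).add ((rf_half_tendsto hz).const_mul (g z * √z))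
  rw [mul_zero, add_zero] at h
  refine h.congr' ?_
  filter_upwards [self_mem_nhdsWithin] with ε hε
  have i1 := hi.mono_set (rfS_sub z ε)
  have i2 := (rf_int_trunc hz hε (g := fun y : ℝ => ((y ^ (-(1/2) : ℝ) : ℝ) : ℂ)) (by fun_prop)
    rf_half_cint).const_mul (g z * √z)
  rw [← integral_const_mul, ← integral_add i1 i2]
  congr 1
  ext y
  ring

lemma rf_negpow {w : ℂ} (hw : 0 < w.im) (b : ℝ) :
    (-w) ^ (b : ℂ) = w ^ (b : ℂ) *
      ((Real.cos (Real.pi * b) : ℂ) - Complex.I * (Real.sin (Real.pi * b) : ℂ)) := by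
  have hw0 : w ≠ 0 := by rintro rfl; simp at hw
  have hlog : Complex.log (-w) = Complex.log w - Real.pi * Complex.I := by
    rw [Complex.log, Complex.log, norm_neg, Complex.arg_neg_eq_arg_sub_pi_of_im_pos hw]
    push_cast; ring
  rw [Complex.cpow_def_of_ne_zero (neg_ne_zero.2 hw0), Complex.cpow_def_of_ne_zero hw0, hlog,
    sub_mul, sub_eq_add_neg, Complex.exp_add]
  congr 1
  rw [show -(Real.pi * Complex.I * (b : ℂ)) = (-((Real.pi * b : ℝ) : ℂ)) * Complex.I by
    push_cast; ring, Complex.exp_mul_I, Complex.cos_neg, Complex.sin_neg]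
  push_cast; ring

lemma rf_neg_slit {w : ℂ} (hw : 0 < w.im) : -w ∈ Complex.slitPlane := by
  right; simpa using hw.ne'

lemma rf_Gw {b : ℝ} (hb : -1 < b) (hb0 : b < 0) {w : ℂ} (hw : 0 < w.im) :
    ∫ y in Ioi (0:ℝ), ((y ^ b : ℝ) : ℂ) / (y - w)
      = w ^ (b : ℂ) * ((Real.cos (Real.pi * b) : ℂ) - Complex.I * (Real.sin (Real.pi * b) : ℂ)) *
        ((Real.pi / Real.sin (Real.pi * (b + 1)) : ℝ) : ℂ) := by
  have := rf_G hb hb0 (rf_neg_slit hw)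
  rw [rf_negpow hw] at this
  simpa only [← sub_eq_add_neg] using this

lemma rf_Gw_int {b : ℝ} (hb : -1 < b) (hb0 : b < 0) {w : ℂ} (hw : 0 < w.im) :
    IntegrableOn (fun y : ℝ => ((y ^ b : ℝ) : ℂ) / (y - w)) (Ioi 0) := by
  simpa only [← sub_eq_add_neg] using rf_cint hb hb0 (rf_neg_slit hw)

lemma rf_M {b z : ℝ} (hb : -1 < b) (hb0 : b < 0) (hz : 0 < z) :
    Tendsto (fun ε : ℝ => ∫ y in rfS z ε, ((y ^ b : ℝ) : ℂ) / (y - z)) (nhdsWithin 0 (Ioi 0))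
      (nhds (((z ^ b * Real.cos (Real.pi * b) * (Real.pi / Real.sin (Real.pi * (b + 1))) : ℝ)) : ℂ)) := by
  have hs := Real.sqrt_pos.2 hz
  have hdb : DifferentiableAt ℝ (fun y : ℝ => ((y ^ b : ℝ) : ℂ)) z :=
    (Real.hasDerivAt_rpow_const (x := z) (p := b) (Or.inl hz.ne')).ofReal_comp.differentiableAt
  obtain ⟨hi, ht⟩ := rf_pv (g := fun y : ℝ => ((y ^ b : ℝ) : ℂ)) hz (by fun_prop)
    (rf_cint hb hb0 (by simp)) hdb
  convert ht using 2
  have hw : ∀ ε : ℝ, 0 < ε → 0 < ((z : ℂ) + ε * Complex.I).im := by intro ε hε; simpa using hε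
  -- limit along the upper half plane
  have t1 : Tendsto (fun ε : ℝ => ∫ y in Ioi (0:ℝ),
      (((y ^ b : ℝ) : ℂ) - ((z ^ b : ℝ) : ℂ) * √z * ((y ^ (-(1/2) : ℝ) : ℝ) : ℂ)) /
        (y - ((z : ℂ) + ε * Complex.I))) (nhdsWithin 0 (Ioi 0))
      (nhds (∫ y in Ioi (0:ℝ),
      (((y ^ b : ℝ) : ℂ) - ((z ^ b : ℝ) : ℂ) * √z * ((y ^ (-(1/2) : ℝ) : ℝ) : ℂ)) /
        (y - z))) := by
    refine tendsto_integral_filter_of_dominated_convergence _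
      (Eventually.of_forall fun ε => Measurable.aestronglyMeasurable (by fun_prop)) ?_ hi.norm ?_
    · refine Eventually.of_forall fun ε => ?_
      have hz : ∀ᵐ y ∂(volume.restrict (Ioi (0:ℝ))), y ≠ z :=
        ae_restrict_of_ae (Measure.ae_ne volume z)
      filter_upwards [hz] with y hy
      rw [norm_div, norm_div]
      have h1 : ‖(y : ℂ) - z‖ ≤ ‖(y : ℂ) - ((z : ℂ) + ε * Complex.I)‖ := by
        have := Complex.abs_re_le_norm ((y : ℂ) - ((z : ℂ) + ε * Complex.I))
        rw [← Complex.ofReal_sub, Complex.norm_real, Real.norm_eq_abs]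
        simpa using this
      have h2 : 0 < ‖(y : ℂ) - z‖ := by
        rw [← Complex.ofReal_sub, Complex.norm_real, norm_pos_iff]
        exact sub_ne_zero.2 hy
      gcongr
    · have hz : ∀ᵐ y ∂(volume.restrict (Ioi (0:ℝ))), y ≠ z :=
        ae_restrict_of_ae (Measure.ae_ne volume z)
      filter_upwards [hz] with y hy
      have h2 : (y : ℂ) - z ≠ 0 := by
        rw [← Complex.ofReal_sub]
        exact_mod_cast sub_ne_zero.2 hy
      have : ContinuousAt (fun ε : ℝ => (((y ^ b : ℝ) : ℂ) - ((z ^ b : ℝ) : ℂ) * √z *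
        ((y ^ (-(1/2) : ℝ) : ℝ) : ℂ)) / (y - ((z : ℂ) + ε * Complex.I))) 0 :=
        ContinuousAt.div (by fun_prop) (by fun_prop) (by simpa using h2)
      have h := this.tendsto
      simp only [Complex.ofReal_zero, zero_mul, add_zero] at h
      exact h.mono_left nhdsWithin_le_nhds
  have hpow : ∀ p : ℝ, Tendsto (fun ε : ℝ => ((z : ℂ) + ε * Complex.I) ^ (p : ℂ))
      (nhdsWithin 0 (Ioi 0)) (nhds ((z ^ p : ℝ) : ℂ)) := by
    intro p
    have : ContinuousAt (fun ε : ℝ => ((z : ℂ) + ε * Complex.I) ^ (p : ℂ)) 0 :=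
      ContinuousAt.cpow (by fun_prop) (by fun_prop) (by left; simpa using hz)
    have h := this.tendsto
    simp only [Complex.ofReal_zero, zero_mul, add_zero] at h
    rw [Complex.ofReal_cpow hz.le]
    exact h.mono_left nhdsWithin_le_nhds
  have hn1 : (-1:ℝ) < -(1/2) := by norm_num
  have hn2 : (-(1/2):ℝ) < 0 := by norm_num
  have t2 := (((hpow b).mul_const ((Real.cos (Real.pi * b) : ℂ) -
      Complex.I * (Real.sin (Real.pi * b) : ℂ))).mul_const
        ((Real.pi / Real.sin (Real.pi * (b + 1)) : ℝ) : ℂ)).sub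
    ((((hpow (-(1/2))).mul_const ((Real.cos (Real.pi * (-(1/2) : ℝ)) : ℂ) -
      Complex.I * (Real.sin (Real.pi * (-(1/2) : ℝ)) : ℂ))).mul_const
        ((Real.pi / Real.sin (Real.pi * (-(1/2) + 1)) : ℝ) : ℂ)).const_mul
          (((z ^ b : ℝ) : ℂ) * √z))
  have t3 := tendsto_nhds_unique (t2.congr' ?_) t1
  · rw [← t3]
    have e1 : Real.sin (Real.pi * (b + 1)) = - Real.sin (Real.pi * b) := by
      rw [mul_add, mul_one, Real.sin_add_pi]
    have hS := (rf_sin_pos hb hb0).ne'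
    rw [e1] at hS
    have hS' : (Real.sin (Real.pi * b) : ℂ) ≠ 0 := by exact_mod_cast neg_ne_zero.1 hS
    have e2 : Real.cos (Real.pi * (-(1/2))) = 0 := by
      rw [show Real.pi * (-(1/2)) = -(Real.pi / 2) by ring, Real.cos_neg, Real.cos_pi_div_two]
    have e3 : Real.sin (Real.pi * (-(1/2))) = -1 := by
      rw [show Real.pi * (-(1/2)) = -(Real.pi / 2) by ring, Real.sin_neg, Real.sin_pi_div_two]
    have e4 : Real.sin (Real.pi * (-(1/2) + 1)) = 1 := by
      rw [show Real.pi * (-(1/2) + 1) = (Real.pi / 2) by ring, Real.sin_pi_div_two]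
    have e5 : (√z : ℂ) * ((z ^ (-(1/2) : ℝ) : ℝ) : ℂ) = 1 := by
      rw [← Complex.ofReal_mul, Real.rpow_neg hz.le, ← Real.sqrt_eq_rpow,
        mul_inv_cancel₀ hs.ne', Complex.ofReal_one]
    rw [e1, e2, e3, e4]
    generalize Real.sin (Real.pi * b) = S at *
    generalize Real.cos (Real.pi * b) = Cc at *
    generalize z ^ b = Z at *
    generalize z ^ (-(1/2) : ℝ) = Y at *
    push_cast
    field_simp
    linear_combination ((Z : ℂ) * S * Complex.I) * e5
  · filter_upwards [self_mem_nhdsWithin] with ε hε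
    have i1 := rf_Gw_int hb hb0 (hw ε hε)
    have i2 := (rf_Gw_int hn1 hn2 (hw ε hε)).const_mul (((z ^ b : ℝ) : ℂ) * √z)
    rw [← rf_Gw hb hb0 (hw ε hε), ← rf_Gw hn1 hn2 (hw ε hε), ← integral_const_mul,
      ← integral_sub i1 i2]
    congr 1
    ext y
    ring

lemma rf_g_int {a z : ℝ} (ha : -1 < a) (ha2 : a < 2) (hz : 0 < z) {w : ℂ} (hw : 0 < w.im) :
    IntegrableOn (fun y : ℝ => ((y ^ a : ℝ) : ℂ) / ((y - w) * (y + z)) / (y + 1)) (Ioi 0) := by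
  obtain ⟨m, hm, h⟩ := rf_slit (rf_neg_slit hw)
  obtain ⟨m', hm', h'⟩ := rf_slit (c := (z : ℂ)) (by left; simpa using hz)
  obtain ⟨b, hb1, hb2⟩ : ∃ b : ℝ, max (-1) (a - 2) < b ∧ b < min 0 a := by
    apply exists_between
    simp only [max_lt_iff, lt_min_iff]
    refine ⟨⟨?_, ?_⟩, ?_, ?_⟩ <;> linarith
  rw [max_lt_iff] at hb1
  rw [lt_min_iff] at hb2
  refine Integrable.mono' ((rf_intg hb1.1 hb2.1 one_pos).const_mul (1 / (m * m')))
    (Measurable.aestronglyMeasurable (by fun_prop)) ?_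
  refine (ae_restrict_iff' measurableSet_Ioi).2 (Eventually.of_forall fun y hy => ?_)
  have hy' : (0:ℝ) < y := hy
  have h0 : 0 ≤ y ^ a := Real.rpow_nonneg hy'.le _
  have h1 := h (-w) (Metric.mem_ball_self hm) y hy
  have h2 := h' z (Metric.mem_ball_self hm') y hy
  rw [← sub_eq_add_neg] at h1
  have h3 : y ^ a ≤ y ^ b * (y + 1) ^ 2 := by
    have e : y ^ a = y ^ b * y ^ (a - b) := by rw [← Real.rpow_add hy']; congr 1; ring
    rw [e]
    gcongr
    calc y ^ (a - b) ≤ (y + 1) ^ (a - b) :=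
          Real.rpow_le_rpow hy'.le (by linarith) (by linarith)
      _ ≤ (y + 1) ^ (2 : ℝ) := Real.rpow_le_rpow_of_exponent_le (by linarith) (by linarith)
      _ = (y + 1) ^ 2 := by norm_cast
  rw [norm_div, norm_div, norm_mul, Complex.norm_real, Real.norm_of_nonneg h0,
    show (y : ℂ) + 1 = ((y + 1 : ℝ) : ℂ) by push_cast; rfl, Complex.norm_real,
    Real.norm_of_nonneg (by positivity : 0 ≤ y + 1)]
  calc y ^ a / (‖(y : ℂ) - w‖ * ‖(y : ℂ) + z‖) / (y + 1)
      ≤ y ^ b * (y + 1) ^ 2 / ((m * (y + 1)) * (m' * (y + 1))) / (y + 1) := by gcongr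
    _ = _ := by field_simp

lemma rf_ne {w : ℂ} (hw : 0 < w.im) (y : ℝ) : (y : ℂ) - w ≠ 0 := by
  intro h
  have := congrArg Complex.im h
  simp at this
  exact hw.ne' this

lemma rf_ne' {w : ℂ} (hw : 0 < w.im) (y : ℝ) : (y : ℂ) + w ≠ 0 := by
  intro h
  have := congrArg Complex.im h
  simp at this
  exact hw.ne' this

lemma rf_exists {a z : ℝ} (ha : -1 < a) (ha2 : a < 2) (hz : 0 < z) {w : ℂ} (hw : 0 < w.im) :
    ∃ L : ℂ, Tendsto (fun ε : ℝ => ∫ y in rfS z ε,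
      ((y ^ a : ℝ) : ℂ) / ((y - w) * (y + z)) / (y - z)) (nhdsWithin 0 (Ioi 0)) (nhds L) := by
  refine ⟨_, (rf_pv (g := fun y : ℝ => ((y ^ a : ℝ) : ℂ) / ((y - w) * (y + z))) hz
    (by fun_prop) (rf_g_int ha ha2 hz hw) ?_).2⟩
  have hd : DifferentiableAt ℝ (fun y : ℝ => ((y ^ a : ℝ) : ℂ)) z :=
    (Real.hasDerivAt_rpow_const (x := z) (p := a) (Or.inl hz.ne')).ofReal_comp.differentiableAt
  have hc : DifferentiableAt ℝ (fun y : ℝ => (y : ℂ)) z :=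
    Complex.ofRealCLM.differentiableAt
  refine DifferentiableAt.fun_div hd ((hc.sub_const w).fun_mul (hc.add_const (z : ℂ))) ?_
  refine mul_ne_zero (rf_ne hw z) ?_
  norm_cast
  linarith

lemma rf_real {a z x t β γ : ℝ} (ha : -1 < a) (ha2 : a < 2) (hz : 0 < z) (ht : 0 < t) {L : ℂ}
    (hL : Tendsto (fun ε : ℝ => ∫ y in rfS z ε,
      ((y ^ a : ℝ) : ℂ) / ((y - ((x : ℂ) + t * Complex.I)) * (y + z)) / (y - z))
        (nhdsWithin 0 (Ioi 0)) (nhds L)) :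
    Tendsto
        (fun ε : ℝ => ∫ y in rfS z ε,
          ((γ * t + β * (y - x)) / (t ^ 2 + (y - x) ^ 2)) *
            (y ^ a / (y ^ 2 - z ^ 2)))
        (nhdsWithin (0 : ℝ) (Ioi 0)) (nhds (((β : ℂ) - Complex.I * γ) * L).re) := by
  have hw : 0 < ((x : ℂ) + t * Complex.I).im := by simpa using ht
  have h := (Complex.continuous_re.tendsto _).comp (hL.const_mul ((β : ℂ) - Complex.I * γ))
  refine h.congr' ?_
  filter_upwards [self_mem_nhdsWithin] with ε hε
  have hi := (rf_int_trunc (g := fun y : ℝ => ((y ^ a : ℝ) : ℂ) /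
    ((y - ((x : ℂ) + t * Complex.I)) * (y + z))) hz hε (by fun_prop)
    (rf_g_int ha ha2 hz hw)).const_mul ((β : ℂ) - Complex.I * γ)
  simp only [Function.comp]
  rw [← integral_const_mul]
  have := Complex.reCLM.integral_comp_comm hi
  simp only [Complex.reCLM_apply] at this
  rw [← this]
  refine setIntegral_congr_fun (rfS_meas z ε) fun y hy => ?_
  have hD : 0 < t ^ 2 + (y - x) ^ 2 := by positivity
  have e1 : ((y : ℂ) - ((x : ℂ) + t * Complex.I))⁻¹ =
      ((y : ℂ) - x + t * Complex.I) * (((t ^ 2 + (y - x) ^ 2 : ℝ)) : ℂ)⁻¹ := by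
    have h1 := rf_ne hw y
    have h2 : ((t ^ 2 + (y - x) ^ 2 : ℝ) : ℂ) ≠ 0 := by exact_mod_cast hD.ne'
    field_simp
    push_cast
    linear_combination ((t : ℂ) ^ 2) * Complex.I_sq
  have e2 : ((β : ℂ) - Complex.I * γ) * (((y ^ a : ℝ) : ℂ) /
    ((y - ((x : ℂ) + t * Complex.I)) * (y + z)) / (y - z)) =
      (((y ^ a / (y ^ 2 - z ^ 2) / (t ^ 2 + (y - x) ^ 2) : ℝ)) : ℂ) *
        (((β : ℂ) - Complex.I * γ) * ((y : ℂ) - x + t * Complex.I)) := by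
    rw [div_div, mul_assoc, div_eq_mul_inv, mul_inv, e1]
    push_cast
    rw [show ((y : ℂ) + z) * (y - z) = y ^ 2 - z ^ 2 by ring]
    simp only [div_eq_mul_inv]
    ring
  rw [e2, Complex.re_ofReal_mul]
  simp
  ring

lemma rf_J {b z : ℝ} (hb : -1 < b) (hb0 : b < 0) (hz : 0 < z) {w : ℂ} (hw : 0 < w.im)
    (n : ℕ) (hn : n ≤ 2) :
    Tendsto (fun ε : ℝ => ∫ y in rfS z ε,
      ((y ^ (b + n) : ℝ) : ℂ) / ((y - w) * (y + z)) / (y - z)) (nhdsWithin 0 (Ioi 0))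
      (nhds (w ^ n / (w ^ 2 - z ^ 2) *
        (w ^ (b : ℂ) * ((Real.cos (Real.pi * b) : ℂ) - Complex.I * (Real.sin (Real.pi * b) : ℂ)) *
          ((Real.pi / Real.sin (Real.pi * (b + 1)) : ℝ) : ℂ)) +
        z ^ n / ((z - w) * (2 * z)) *
          ((z ^ b * Real.cos (Real.pi * b) * (Real.pi / Real.sin (Real.pi * (b + 1))) : ℝ) : ℂ) +
        (-z) ^ n / ((z + w) * (2 * z)) *
          ((z ^ b * (Real.pi / Real.sin (Real.pi * (b + 1))) : ℝ) : ℂ))) := by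
  have hzs : (z : ℂ) ∈ Complex.slitPlane := by left; simpa using hz
  have hz0 : (z : ℂ) ≠ 0 := by exact_mod_cast hz.ne'
  have i1 := rf_Gw_int hb hb0 hw
  have i3 := rf_cint hb hb0 hzs
  have t1 := rf_trunc z i1
  have t3 := rf_trunc z i3
  have t2 := rf_M hb hb0 hz
  rw [rf_Gw hb hb0 hw] at t1
  rw [rf_G hb hb0 hzs, ← Complex.ofReal_cpow hz.le, ← Complex.ofReal_mul] at t3
  have hT := ((t1.const_mul (w ^ n / (w ^ 2 - z ^ 2))).add
    (t2.const_mul ((z : ℂ) ^ n / ((z - w) * (2 * z))))).add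
    (t3.const_mul ((-(z : ℂ)) ^ n / ((z + w) * (2 * z))))
  refine hT.congr' ?_
  filter_upwards [self_mem_nhdsWithin] with ε hε
  have hε' : 0 < ε := hε
  have j1 := (i1.mono_set (rfS_sub z ε)).integrable.const_mul (w ^ n / (w ^ 2 - z ^ 2))
  have j3 := (i3.mono_set (rfS_sub z ε)).integrable.const_mul ((-(z : ℂ)) ^ n / ((z + w) * (2 * z)))
  have j2 := (rf_int_trunc (g := fun y : ℝ => ((y ^ b : ℝ) : ℂ)) hz hε (by fun_prop)
    (rf_cint hb hb0 (by simp))).integrable.const_mul ((z : ℂ) ^ n / ((z - w) * (2 * z)))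
  rw [← integral_const_mul, ← integral_const_mul, ← integral_const_mul, ← integral_add j1 j2]
  have := integral_add (j1.add j2) j3
  simp only [Pi.add_apply] at this
  rw [← this]
  refine setIntegral_congr_fun (rfS_meas z ε) fun y hy => ?_
  have hy0 : 0 < y := hy.1
  have k1 := rf_ne hw y
  have k2 : (y : ℂ) - z ≠ 0 := by
    have : y - z ≠ 0 := abs_pos.1 (hε'.trans hy.2)
    exact_mod_cast this
  have k3 : (y : ℂ) + z ≠ 0 := by
    have : y + z ≠ 0 := by positivity
    exact_mod_cast this
  have k4 := rf_ne hw z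
  have k5 := rf_ne' hw z
  have k6 : w ^ 2 - (z : ℂ) ^ 2 = -((z - w) * (z + w)) := by ring
  rw [Real.rpow_add hy0, Real.rpow_natCast, k6]
  generalize y ^ b = Y
  push_cast
  interval_cases n
  · field_simp
    ring
  · field_simp
    ring
  · field_simp
    ring

lemma rf_alg {α k z : ℝ} (hk : k = Real.tan (Real.pi * α / 2)) (hc : Real.cos (Real.pi * α / 2) ≠ 0)
    (hk0 : k ≠ 0) (hz : 0 < z) {w : ℂ} (hw : 0 < w.im) {b : ℝ} {n : ℕ} (hbn : 1 + α = b + n) :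
    ((2 * (k / Real.pi) * z ^ (-α) : ℝ) : ℂ) * (w ^ n / (w ^ 2 - z ^ 2) *
        (w ^ (b : ℂ) * ((Real.cos (Real.pi * b) : ℂ) - Complex.I * (Real.sin (Real.pi * b) : ℂ)) *
          ((Real.pi / Real.sin (Real.pi * (b + 1)) : ℝ) : ℂ)) +
        z ^ n / ((z - w) * (2 * z)) *
          ((z ^ b * Real.cos (Real.pi * b) * (Real.pi / Real.sin (Real.pi * (b + 1))) : ℝ) : ℂ) +
        (-z) ^ n / ((z + w) * (2 * z)) *
          ((z ^ b * (Real.pi / Real.sin (Real.pi * (b + 1))) : ℝ) : ℂ)) =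
      (((k ^ 2 - 1) / 2 : ℝ) : ℂ) * (1 / (z - w)) + (((k ^ 2 + 1) / 2 : ℝ) : ℂ) * (1 / (z + w)) -
        (1 - Complex.I * k) ^ 2 * w ^ ((1 : ℂ) + α) / (w ^ 2 - z ^ 2) * ((z ^ (-α) : ℝ) : ℂ) := by
  set θ := Real.pi * α / 2 with hθ
  have hs : Real.sin θ = k * Real.cos θ := by rw [hk, Real.tan_mul_cos hc]
  have h1 : Real.cos θ ^ 2 * (1 + k ^ 2) = 1 := by
    have := Real.sin_sq_add_cos_sq θ
    rw [hs] at this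
    linarith
  have hpi := Real.pi_ne_zero
  have hK : 1 + k ^ 2 ≠ 0 := by positivity
  have hK' : (1 + (k : ℂ) ^ 2) ≠ 0 := by exact_mod_cast hK
  have hC2 : Real.cos θ ^ 2 = 1 / (1 + k ^ 2) := by field_simp; linarith
  have hsin2 : Real.sin (2 * θ) = 2 * k / (1 + k ^ 2) := by
    rw [Real.sin_two_mul, hs, show 2 * (k * Real.cos θ) * Real.cos θ = 2 * k * Real.cos θ ^ 2 by ring,
      hC2]; ring
  have hcos2 : Real.cos (2 * θ) = (1 - k ^ 2) / (1 + k ^ 2) := by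
    rw [Real.cos_two_mul, hC2]; field_simp; ring
  have eb : Real.pi * b = 2 * θ + Real.pi - n * Real.pi := by
    rw [show b = 1 + α - n by linarith, hθ]; ring
  have eb1 : Real.pi * (b + 1) = 2 * θ + 2 * Real.pi - n * Real.pi := by
    rw [show b = 1 + α - n by linarith, hθ]; ring
  obtain ⟨σ, hσ, hσ2⟩ : ∃ σ : ℝ, σ = (-1) ^ n ∧ σ ^ 2 = 1 := ⟨_, rfl, by
    rw [← pow_mul, mul_comm, pow_mul]; simp⟩
  have hσ0 : σ ≠ 0 := by rintro rfl; simp at hσ2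
  have f1 : Real.cos (Real.pi * b) = -σ * ((1 - k ^ 2) / (1 + k ^ 2)) := by
    rw [eb, Real.cos_sub_nat_mul_pi, Real.cos_add_pi, hcos2, hσ]; ring
  have f2 : Real.sin (Real.pi * b) = -σ * (2 * k / (1 + k ^ 2)) := by
    rw [eb, Real.sin_sub_nat_mul_pi, Real.sin_add_pi, hsin2, hσ]; ring
  have f3 : Real.pi / Real.sin (Real.pi * (b + 1)) = σ * (Real.pi * (1 + k ^ 2) / (2 * k)) := by
    rw [eb1, Real.sin_sub_nat_mul_pi, Real.sin_add_two_pi, hsin2, ← hσ]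
    field_simp
    linarith
  have hw0 : w ≠ 0 := by rintro rfl; simp at hw
  have g1 : w ^ ((1 : ℂ) + α) = w ^ n * w ^ (b : ℂ) := by
    rw [show (1 : ℂ) + α = (n : ℂ) + b by
      have : ((1 + α : ℝ) : ℂ) = ((b + n : ℝ) : ℂ) := by rw [hbn]
      push_cast at this; rw [this]; ring, Complex.cpow_add _ _ hw0, Complex.cpow_natCast]
  have g2 : (z : ℂ) ^ n * ((z ^ b : ℝ) : ℂ) * ((z ^ (-α) : ℝ) : ℂ) = z := by
    have : z ^ n * z ^ b * z ^ (-α) = z := by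
      rw [← Real.rpow_natCast, ← Real.rpow_add hz, ← Real.rpow_add hz,
        show (n : ℝ) + b + -α = 1 by linarith, Real.rpow_one]
    exact_mod_cast this
  have g3 : (-(z : ℂ)) ^ n = (σ : ℂ) * (z : ℂ) ^ n := by
    rw [neg_pow, hσ]; push_cast; rfl
  have hσ2' : (σ : ℂ) ^ 2 = 1 := by exact_mod_cast hσ2
  have hpi' : (Real.pi : ℂ) ≠ 0 := by exact_mod_cast hpi
  have hk0' : (k : ℂ) ≠ 0 := by exact_mod_cast hk0
  have hz0 : (z : ℂ) ≠ 0 := by exact_mod_cast hz.ne'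
  have k4 := rf_ne hw z
  have k5 := rf_ne' hw z
  have k6 : w ^ 2 - (z : ℂ) ^ 2 ≠ 0 := by
    rw [show w ^ 2 - (z : ℂ) ^ 2 = -((z - w) * (z + w)) by ring]
    exact neg_ne_zero.2 (mul_ne_zero k4 k5)
  rw [f1, f2, f3, g1, g3]
  push_cast
  generalize w ^ (b : ℂ) = Wb at *
  generalize ((z ^ b : ℝ) : ℂ) = Zb at *
  generalize ((z ^ (-α) : ℝ) : ℂ) = Zm at *
  have a1 : 2 * ((k : ℂ) / Real.pi) * Zm * (w ^ n / (w ^ 2 - z ^ 2) *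
      (Wb * (-σ * ((1 - (k : ℂ) ^ 2) / (1 + k ^ 2)) - Complex.I * (-σ * (2 * k / (1 + k ^ 2)))) *
        (σ * (Real.pi * (1 + k ^ 2) / (2 * k))))) =
      -((1 - Complex.I * k) ^ 2 * (w ^ n * Wb) / (w ^ 2 - z ^ 2) * Zm) := by
    field_simp
    linear_combination (Wb * Zm * (-(1 - (k : ℂ) ^ 2) + 2 * Complex.I * k)) * hσ2' +
      (Wb * Zm * (k : ℂ) ^ 2) * Complex.I_sq
  have a2 : 2 * ((k : ℂ) / Real.pi) * Zm * (z ^ n / ((z - w) * (2 * z)) *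
      (Zb * (-σ * ((1 - (k : ℂ) ^ 2) / (1 + k ^ 2))) *
        (σ * (Real.pi * (1 + k ^ 2) / (2 * k))))) = ((k : ℂ) ^ 2 - 1) / 2 * (1 / (z - w)) := by
    field_simp
    linear_combination ((z : ℂ) ^ n * Zb * Zm * ((k : ℂ) ^ 2 - 1)) * hσ2' + ((k : ℂ) ^ 2 - 1) * g2
  have a3 : 2 * ((k : ℂ) / Real.pi) * Zm * (σ * z ^ n / ((z + w) * (2 * z)) *
      (Zb * (σ * (Real.pi * (1 + k ^ 2) / (2 * k))))) =
        ((k : ℂ) ^ 2 + 1) / 2 * (1 / (z + w)) := by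
    field_simp
    linear_combination ((z : ℂ) ^ n * Zb * Zm * ((k : ℂ) ^ 2 + 1)) * hσ2' + ((k : ℂ) ^ 2 + 1) * g2
  rw [mul_add, mul_add, a1, a2, a3]
  ring

lemma rf_alg0 {z : ℝ} {w : ℂ} (hw : 0 < w.im) :
    (0 : ℂ) = (((0 ^ 2 - 1) / 2 : ℝ) : ℂ) * (1 / (z - w)) +
        (((0 ^ 2 + 1) / 2 : ℝ) : ℂ) * (1 / (z + w)) -
        (1 - Complex.I * (0 : ℝ)) ^ 2 * w ^ ((1 : ℂ) + (0 : ℝ)) / (w ^ 2 - z ^ 2) *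
          ((z ^ (-(0 : ℝ)) : ℝ) : ℂ) := by
  have k4 := rf_ne hw z
  have k5 := rf_ne' hw z
  have k6 : w ^ 2 - (z : ℂ) ^ 2 = -((z - w) * (z + w)) := by ring
  rw [k6]
  simp
  field_simp
  ring

lemma rf_re {β γ t x z : ℝ} (ht : 0 < t) :
    (((β : ℂ) - Complex.I * γ) * (1 / (z - ((x : ℂ) + t * Complex.I)))).re =
      (γ * t - β * (x - z)) / (t ^ 2 + (x - z) ^ 2) := by
  have hD : 0 < t ^ 2 + (x - z) ^ 2 := by positivity
  have e1 : ((β : ℂ) - Complex.I * γ) * (1 / ((z : ℂ) - ((x : ℂ) + t * Complex.I))) =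
      (((t ^ 2 + (x - z) ^ 2)⁻¹ : ℝ) : ℂ) *
        (((β : ℂ) - Complex.I * γ) * ((z : ℂ) - x + t * Complex.I)) := by
    have h2 : ((t : ℂ) ^ 2 + ((x : ℂ) - z) ^ 2) ≠ 0 := by exact_mod_cast hD.ne'
    have e0 : ((z : ℂ) - ((x : ℂ) + t * Complex.I))⁻¹ =
        ((z : ℂ) - x + t * Complex.I) * ((t : ℂ) ^ 2 + ((x : ℂ) - z) ^ 2)⁻¹ := by
      apply inv_eq_of_mul_eq_one_right
      rw [← mul_assoc, mul_inv_eq_one₀ h2]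
      linear_combination (-(t : ℂ) ^ 2) * Complex.I_sq
    rw [one_div, e0]
    push_cast
    ring
  rw [e1, Complex.re_ofReal_mul]
  simp
  field_simp
  ring

lemma rf_re' {β γ t x z : ℝ} (ht : 0 < t) :
    (((β : ℂ) - Complex.I * γ) * (1 / (z + ((x : ℂ) + t * Complex.I)))).re =
      -((γ * t - β * (x + z)) / (t ^ 2 + (x + z) ^ 2)) := by
  have := rf_re (β := β) (γ := γ) (x := x) (z := -z) ht
  rw [show x - -z = x + z by ring] at this
  rw [← this, ← Complex.neg_re]
  congr 1
  rw [show ((-z : ℝ) : ℂ) - ((x : ℂ) + t * Complex.I) = -(z + ((x : ℂ) + t * Complex.I)) by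
    push_cast; ring, one_div, one_div, inv_neg]
  ring

/-- the residue calculus formula for the principal value integral
`I_{α,β,γ}(t,x,z) = p.v.∫₀^∞ ((γt + β(y-x))/(t²+(y-x)²)) · (y^{1+α}/(y²-z²)) dy`. -/
theorem residue_formula
    (α : ℝ) (hα : α ∈ Ioo (-2 : ℝ) 1) (hα' : α ≠ -1)
    (k : ℝ) (hk : k = Real.tan (Real.pi * α / 2))
    (β γ t z x : ℝ) (ht : 0 < t) (hz : 0 < z) :
    ∃ I : ℝ,
      Tendsto
        (fun ε : ℝ => ∫ y in {y : ℝ | y ∈ Ioi (0 : ℝ) ∧ ε < |y - z|},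
          ((γ * t + β * (y - x)) / (t ^ 2 + (y - x) ^ 2)) *
            (y ^ (1 + α) / (y ^ 2 - z ^ 2)))
        (nhdsWithin (0 : ℝ) (Ioi 0)) (nhds I) ∧
      2 * (k / Real.pi) * z ^ (-α) * I
        = (k ^ 2 - 1) / 2 * ((γ * t - β * (x - z)) / (t ^ 2 + (x - z) ^ 2))
          - (k ^ 2 + 1) / 2 * ((γ * t - β * (x + z)) / (t ^ 2 + (x + z) ^ 2))
          - (((1 - Complex.I * k) ^ 2 * ((β : ℂ) - Complex.I * γ) *
                ((x : ℂ) + t * Complex.I) ^ ((1 : ℂ) + α) /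
                (((x : ℂ) + t * Complex.I) ^ 2 - (z : ℂ) ^ 2)).re) * z ^ (-α) := by
  obtain ⟨hα1, hα2⟩ := hα
  have ha : -1 < 1 + α := by linarith
  have ha2 : 1 + α < 2 := by linarith
  have hw : 0 < ((x : ℂ) + t * Complex.I).im := by simpa using ht
  suffices H : ∃ L : ℂ, Tendsto (fun ε : ℝ => ∫ y in rfS z ε,
      ((y ^ (1 + α) : ℝ) : ℂ) / ((y - ((x : ℂ) + t * Complex.I)) * (y + z)) / (y - z))
        (nhdsWithin 0 (Ioi 0)) (nhds L) ∧
      ((2 * (k / Real.pi) * z ^ (-α) : ℝ) : ℂ) * L =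
      (((k ^ 2 - 1) / 2 : ℝ) : ℂ) * (1 / (z - ((x : ℂ) + t * Complex.I))) +
        (((k ^ 2 + 1) / 2 : ℝ) : ℂ) * (1 / (z + ((x : ℂ) + t * Complex.I))) -
        (1 - Complex.I * k) ^ 2 * ((x : ℂ) + t * Complex.I) ^ ((1 : ℂ) + α) /
          (((x : ℂ) + t * Complex.I) ^ 2 - z ^ 2) * ((z ^ (-α) : ℝ) : ℂ) by
    obtain ⟨L, hL, hL2⟩ := H
    refine ⟨(((β : ℂ) - Complex.I * γ) * L).re, rf_real ha ha2 hz ht hL, ?_⟩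
    rw [← Complex.re_ofReal_mul, mul_left_comm, hL2, mul_sub, mul_add, mul_left_comm,
      mul_left_comm _ (((k ^ 2 + 1) / 2 : ℝ) : ℂ), Complex.sub_re, Complex.add_re,
      Complex.re_ofReal_mul, Complex.re_ofReal_mul, rf_re ht, rf_re' ht, ← mul_assoc,
      Complex.re_mul_ofReal]
    rw [mul_neg, ← sub_eq_add_neg]
    congr 3
    ring
  by_cases h0 : α = 0
  · obtain ⟨L, hL⟩ := rf_exists ha ha2 hz hw
    refine ⟨L, hL, ?_⟩
    have hk0 : k = 0 := by rw [hk, h0]; simp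
    subst hk0
    subst h0
    rw [← rf_alg0 hw]
    simp
  have hpi := Real.pi_pos
  have hbn : ∃ (b : ℝ) (n : ℕ), n ≤ 2 ∧ -1 < b ∧ b < 0 ∧ 1 + α = b + n := by
    rcases lt_or_gt_of_ne hα' with h | h
    · exact ⟨1 + α, 0, by norm_num, by linarith, by linarith, by simp⟩
    rcases lt_or_gt_of_ne h0 with h' | h'
    · exact ⟨α, 1, by norm_num, by linarith, by linarith, by simp; ring⟩
    · exact ⟨α - 1, 2, by norm_num, by linarith, by linarith, by push_cast; ring⟩
  obtain ⟨b, n, hn, hb, hb0, hbn⟩ := hbn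
  have hS : Real.sin (Real.pi * (b + 1)) ≠ 0 := (rf_sin_pos hb hb0).ne'
  have hS2 : Real.sin (2 * (Real.pi * α / 2)) ≠ 0 := by
    intro h
    apply hS
    rw [show Real.pi * (b + 1) = 2 * (Real.pi * α / 2) + 2 * Real.pi - n * Real.pi by
      rw [show b = 1 + α - n by linarith]; ring, Real.sin_sub_nat_mul_pi, Real.sin_add_two_pi, h,
      mul_zero]
  rw [Real.sin_two_mul] at hS2
  have hc : Real.cos (Real.pi * α / 2) ≠ 0 := right_ne_zero_of_mul hS2
  have hs : Real.sin (Real.pi * α / 2) ≠ 0 := right_ne_zero_of_mul (left_ne_zero_of_mul hS2)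
  have hk0 : k ≠ 0 := by rw [hk, Real.tan_eq_sin_div_cos]; exact div_ne_zero hs hc
  refine ⟨_, ?_, rf_alg hk hc hk0 hz hw hbn⟩
  have := rf_J hb hb0 hz hw n hn
  rwa [← hbn] at this
end

section
/- Let α ∈ (−2,1) with α ≠ −1, set k := tan(πα/2), and let t > 0, x > 0, y > 0. Then (1/π) ∫_0^∞ s^{2+α} / ( (4x²t² + (x² − t² + s²)²)(s² + y²) ) ds = − (1/(2 cos(πα/2))) · y^{1+α} / (4x²t² + (x² − t² − y²)²) + (1/(4xt)) · Re( (1 − ik) (t + ix)^{1+α} / ((t + ix)² + y²) ), where (t+ix)^{1+α} denotes the principal branch of the complex power; the integral on the left converges absolutely. -/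
open MeasureTheory Filter Set
open scoped ENNReal NNReal

lemma int_real (p b : ℝ) (hp : 0 < p) (hb : 0 < b) :
    IntegrableOn (fun t : ℝ => t ^ (p - 1) * Real.exp (-(b * t))) (Ioi 0) := by
  have := integrableOn_rpow_mul_exp_neg_mul_rpow (p := 1) (s := p - 1) (b := b) (by linarith)
    one_pos hb
  simpa using this

lemma norm_term (q : ℝ) (r : ℂ) (t : ℝ) (ht : 0 < t) :
    ‖((t ^ q : ℝ) : ℂ) * Complex.exp (-(r * t))‖ = t ^ q * Real.exp (-(r.re * t)) := by
  rw [norm_mul, Complex.norm_real, Complex.norm_exp, Real.norm_eq_abs,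
    abs_of_nonneg (Real.rpow_nonneg ht.le _)]
  simp

lemma meas_term (q : ℝ) (r : ℂ) :
    Measurable (fun t : ℝ => ((t ^ q : ℝ) : ℂ) * Complex.exp (-(r * t))) := by
  fun_prop

lemma int_term (p : ℝ) (hp : 0 < p) (r : ℂ) (hr : 0 < r.re) :
    IntegrableOn (fun t : ℝ => ((t ^ (p - 1) : ℝ) : ℂ) * Complex.exp (-(r * t))) (Ioi 0) := by
  refine Integrable.mono' (int_real p r.re hp hr) (meas_term _ _).aestronglyMeasurable ?_
  filter_upwards [ae_restrict_mem measurableSet_Ioi] with t ht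
  exact (norm_term _ _ _ ht).le

lemma diff_G (p : ℝ) (hp : 0 < p) (r : ℂ) (hr : 0 < r.re) :
    DifferentiableAt ℂ (fun r : ℂ => ∫ t in Ioi (0:ℝ),
      ((t ^ (p - 1) : ℝ) : ℂ) * Complex.exp (-(r * t))) r := by
  have := hasDerivAt_integral_of_dominated_loc_of_deriv_le (𝕜 := ℂ)
    (μ := volume.restrict (Ioi (0:ℝ)))
    (F := fun (r : ℂ) (t : ℝ) => ((t ^ (p - 1) : ℝ) : ℂ) * Complex.exp (-(r * t)))
    (F' := fun (r : ℂ) (t : ℝ) => ((t ^ (p - 1) : ℝ) : ℂ) * (Complex.exp (-(r * t)) * (-t)))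
    (x₀ := r) (s := Metric.ball r (r.re / 2))
    (bound := fun t => t ^ ((p + 1) - 1) * Real.exp (-((r.re / 2) * t)))
    (Metric.ball_mem_nhds _ (by linarith))
    (Eventually.of_forall fun r' => (meas_term _ _).aestronglyMeasurable)
    (int_term p hp r hr)
    (by
      apply Measurable.aestronglyMeasurable
      fun_prop)
    (by
      filter_upwards [ae_restrict_mem measurableSet_Ioi] with t ht r' hr'
      have ht : 0 < t := ht
      have h1 : r.re / 2 ≤ r'.re := by
        rw [Metric.mem_ball, dist_eq_norm] at hr'
        have := (Complex.abs_re_le_norm (r' - r)).trans hr'.le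
        rw [abs_le] at this
        simp at this
        linarith [this.1]
      rw [← mul_assoc, norm_mul, norm_term _ _ _ ht, norm_neg, Complex.norm_real,
        Real.norm_eq_abs, abs_of_pos ht]
      have : t ^ (p + 1 - 1) = t ^ (p - 1) * t := by
        rw [← Real.rpow_add_one ht.ne']; ring_nf
      rw [this, mul_right_comm]
      gcongr)
    (int_real _ _ (by linarith) (by linarith))
    (by
      filter_upwards with t r' hr'
      have h : HasDerivAt (fun r : ℂ => -(r * t)) (-(t:ℂ)) r' := by
        have h1 := ((hasDerivAt_id r').mul_const (t:ℂ)).fun_neg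
        simpa using h1
      exact h.cexp.const_mul _)
  exact this.2.differentiableAt

lemma G_eq (p : ℝ) (hp : 0 < p) (r : ℂ) (hr : 0 < r.re) :
    ∫ t in Ioi (0:ℝ), ((t ^ (p - 1) : ℝ) : ℂ) * Complex.exp (-(r * t))
      = r ^ (-(p:ℂ)) * (Real.Gamma p : ℂ) := by
  have hopen : IsOpen {r : ℂ | 0 < r.re} := isOpen_lt continuous_const Complex.continuous_re
  have hconv : Convex ℝ {r : ℂ | 0 < r.re} := convex_halfSpace_re_gt 0
  have hA : AnalyticOnNhd ℂ (fun r : ℂ => ∫ t in Ioi (0:ℝ),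
      ((t ^ (p - 1) : ℝ) : ℂ) * Complex.exp (-(r * t))) {r : ℂ | 0 < r.re} :=
    DifferentiableOn.analyticOnNhd (fun r hr => (diff_G p hp r hr).differentiableWithinAt) hopen
  have hB : AnalyticOnNhd ℂ (fun r : ℂ => r ^ (-(p:ℂ)) * (Real.Gamma p : ℂ)) {r : ℂ | 0 < r.re} := by
    refine DifferentiableOn.analyticOnNhd (fun r hr => ?_) hopen
    refine DifferentiableAt.differentiableWithinAt ?_
    refine DifferentiableAt.mul_const ?_ _
    exact DifferentiableAt.cpow differentiableAt_id (differentiableAt_const _) (Or.inl hr)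
  have hre : ∀ x : ℝ, 0 < x → ∫ t in Ioi (0:ℝ), ((t ^ (p - 1) : ℝ) : ℂ) * Complex.exp (-((x:ℂ) * t))
      = (x:ℂ) ^ (-(p:ℂ)) * (Real.Gamma p : ℂ) := by
    intro x hx
    have h := congrArg (fun z : ℝ => (z : ℂ)) (Real.integral_rpow_mul_exp_neg_mul_Ioi hp hx)
    rw [← integral_complex_ofReal] at h
    have e : (x:ℂ) ^ (-(p:ℂ)) = (((1 / x) ^ p : ℝ) : ℂ) := by
      rw [one_div, Real.inv_rpow hx.le, ← Real.rpow_neg hx.le, Complex.ofReal_cpow hx.le]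
      simp
    rw [e, ← Complex.ofReal_mul, ← h]
    congr 1
    ext t
    push_cast
    rfl
  refine hA.eqOn_of_preconnected_of_frequently_eq hB hconv.isPreconnected
    (z₀ := 1) (by simp) ?_ hr
  have hT : Tendsto (fun n : ℕ => ((1 + 1 / ((n:ℝ) + 1) : ℝ) : ℂ)) atTop (nhdsWithin 1 {1}ᶜ) := by
    rw [tendsto_nhdsWithin_iff]
    constructor
    · have := (tendsto_one_div_add_atTop_nhds_zero_nat (𝕜 := ℝ)).const_add 1
      have := (Complex.continuous_ofReal.tendsto _).comp this
      simpa [Function.comp_def] using this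
    · filter_upwards with n
      have : (0:ℝ) < 1 / ((n:ℝ) + 1) := by positivity
      intro h
      have h' : ((1 + 1 / ((n:ℝ) + 1) : ℝ) : ℂ) = ((1:ℝ):ℂ) := by rw [h]; simp
      rw [Complex.ofReal_inj] at h'
      linarith
  refine hT.frequently (Frequently.of_forall fun n => ?_)
  exact hre _ (by positivity)

lemma zz (ζ : ℂ) (hζ : 0 < ζ.re) : 0 < (ζ⁻¹).re := by
  rw [Complex.inv_re]
  have : ζ ≠ 0 := by rintro rfl; simp at hζ
  have := Complex.normSq_pos.2 this
  positivity

lemma inner_u (ζ : ℂ) (hζ : 0 < ζ.re) (v : ℝ) (hv : 0 < v) :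
    ∫ u in Ioi (0:ℝ), Complex.exp (-(u * (v * ζ⁻¹ + ζ))) = ζ / (v + ζ ^ 2) := by
  have h0 : ζ ≠ 0 := by rintro rfl; simp at hζ
  have hre : (-(v * ζ⁻¹ + ζ)).re < 0 := by
    have := mul_pos hv (zz ζ hζ)
    rw [Complex.neg_re, Complex.add_re, Complex.re_ofReal_mul]
    linarith
  have := integral_exp_mul_complex_Ioi hre 0
  have e : v * ζ⁻¹ + ζ = (v + ζ ^ 2) / ζ := by field_simp
  rw [show (fun u : ℝ => Complex.exp (-(u * (v * ζ⁻¹ + ζ)))) =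
    fun u : ℝ => Complex.exp (-(v * ζ⁻¹ + ζ) * u) by ext u; ring_nf, this]
  simp only [Complex.ofReal_zero, mul_zero, Complex.exp_zero, neg_div_neg_eq]
  rw [e, one_div_div]

lemma key1 (p : ℝ) (hp : 0 < p) (hp1 : p < 1) (ζ : ℂ) (hζ : 0 < ζ.re) :
    IntegrableOn (fun v : ℝ => ((v ^ (p - 1) : ℝ) : ℂ) * (ζ / (v + ζ ^ 2))) (Ioi 0) ∧
    ∫ v in Ioi (0:ℝ), ((v ^ (p - 1) : ℝ) : ℂ) * (ζ / (v + ζ ^ 2)) =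
      ζ ^ (2 * (p:ℂ) - 1) * ((Real.pi / Real.sin (Real.pi * p) : ℝ) : ℂ) := by
  have h0 : ζ ≠ 0 := by rintro rfl; simp at hζ
  set f : ℝ → ℝ → ℂ := fun v u =>
    ((v ^ (p - 1) : ℝ) : ℂ) * Complex.exp (-(u * (v * ζ⁻¹ + ζ))) with hf
  have hsplit : ∀ v u : ℝ, f v u =
      (((v ^ (p - 1) : ℝ) : ℂ) * Complex.exp (-((u * ζ⁻¹) * v))) * Complex.exp (-(ζ * u)) := by
    intro v u
    simp only [hf]
    rw [mul_assoc, ← Complex.exp_add]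
    ring_nf
  have hpos : ∀ u : ℝ, 0 < u → 0 < (u * ζ⁻¹).re := fun u hu => by
    rw [Complex.re_ofReal_mul]; exact mul_pos hu (zz ζ hζ)
  have hint : Integrable (Function.uncurry f)
      ((volume.restrict (Ioi (0:ℝ))).prod (volume.restrict (Ioi (0:ℝ)))) := by
    rw [integrable_prod_iff']
    · constructor
      · filter_upwards [ae_restrict_mem measurableSet_Ioi] with u hu
        simp only [Function.uncurry_apply_pair, hsplit]
        exact (int_term p hp _ (hpos u hu)).mul_const _
      · have : IntegrableOn (fun u : ℝ => ((1 / (ζ⁻¹).re) ^ p * Real.Gamma p) *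
            (u ^ ((1 - p) - 1) * Real.exp (-(ζ.re * u)))) (Ioi 0) :=
          (int_real (1 - p) ζ.re (by linarith) hζ).const_mul _
        refine this.congr ?_
        filter_upwards [ae_restrict_mem measurableSet_Ioi] with u hu
        have hu : 0 < u := hu
        simp only [Function.uncurry_apply_pair, hsplit]
        have e : ∫ v in Ioi (0:ℝ), ‖((v ^ (p - 1) : ℝ) : ℂ) * Complex.exp (-((u * ζ⁻¹) * v)) * Complex.exp (-(ζ * u))‖
          = ∫ v in Ioi (0:ℝ), v ^ (p - 1) * Real.exp (-((u * ζ⁻¹).re * v)) * Real.exp (-(ζ.re * u)) := by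
          refine setIntegral_congr_fun measurableSet_Ioi fun v hv => ?_
          rw [norm_mul, norm_term _ _ _ hv, Complex.norm_exp]
          simp
        rw [e, integral_mul_const, Real.integral_rpow_mul_exp_neg_mul_Ioi hp (hpos u hu),
          Complex.re_ofReal_mul]
        have h1 := zz ζ hζ
        have : (1 / (u * (ζ⁻¹).re)) ^ p = (1 / (ζ⁻¹).re) ^ p * u ^ (1 - p - 1) := by
          rw [show 1 / (u * (ζ⁻¹).re) = 1 / (ζ⁻¹).re * u⁻¹ by field_simp,
            Real.mul_rpow (by positivity) (by positivity), Real.inv_rpow hu.le,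
            ← Real.rpow_neg hu.le]
          ring_nf
        rw [this]; ring
    · apply Measurable.aestronglyMeasurable
      simp only [hf, Function.uncurry_def]
      fun_prop
  have hI := hint.integral_prod_left
  have hin : ∀ v : ℝ, 0 < v → ∫ u in Ioi (0:ℝ), f v u =
      ((v ^ (p - 1) : ℝ) : ℂ) * (ζ / (v + ζ ^ 2)) := by
    intro v hv
    rw [← inner_u ζ hζ v hv, ← integral_const_mul]
  constructor
  · refine hI.congr ?_
    filter_upwards [ae_restrict_mem measurableSet_Ioi] with v hv
    exact hin v hv
  · rw [← setIntegral_congr_fun measurableSet_Ioi hin, integral_integral_swap hint]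
    have : ∀ u ∈ Ioi (0:ℝ), ∫ v in Ioi (0:ℝ), f v u = (ζ ^ (p:ℂ) * (Real.Gamma p : ℂ)) *
        (((u ^ ((1 - p) - 1) : ℝ) : ℂ) * Complex.exp (-(ζ * u))) := by
      intro u hu
      have hu : 0 < u := hu
      simp only [hsplit]
      rw [integral_mul_const, G_eq p hp _ (hpos u hu)]
      have : (u * ζ⁻¹) ^ (-(p:ℂ)) = ((u ^ ((1 - p) - 1) : ℝ) : ℂ) * ζ ^ (p:ℂ) := by
        have ha : ζ.arg ≠ Real.pi := by
          intro h
          rw [Complex.arg_eq_pi_iff] at h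
          linarith [h.1]
        have hu0 : (u:ℂ) ≠ 0 := by exact_mod_cast hu.ne'
        rw [Complex.ofReal_cpow hu.le, Complex.cpow_def_of_ne_zero (mul_ne_zero hu0 (inv_ne_zero h0)),
          Complex.log_ofReal_mul hu (inv_ne_zero h0), Complex.log_inv _ ha,
          Complex.cpow_def_of_ne_zero h0, Complex.cpow_def_of_ne_zero hu0, ← Complex.exp_add,
          Complex.ofReal_log hu.le]
        congr 1
        push_cast
        ring
      rw [this]; ring
    rw [setIntegral_congr_fun measurableSet_Ioi this, integral_const_mul,
      G_eq (1 - p) (by linarith) ζ hζ, ← Real.Gamma_mul_Gamma_one_sub]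
    rw [show 2 * (p:ℂ) - 1 = p + (-((1 - p : ℝ) : ℂ)) by push_cast; ring, Complex.cpow_add _ _ h0]
    push_cast
    ring

lemma add_sq_ne (ζ : ℂ) (hζ : 0 < ζ.re) (s : ℝ) (hs : 0 < s) : (s:ℂ) ^ 2 + ζ ^ 2 ≠ 0 := by
  intro h
  have hi := congrArg Complex.im h
  have hr := congrArg Complex.re h
  simp [pow_two] at hi hr
  have : ζ.im = 0 := by
    have : ζ.re * ζ.im = 0 := by linarith
    rcases mul_eq_zero.1 this with h | h
    · linarith
    · exact h
  rw [this] at hr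
  nlinarith [mul_pos hs hs, mul_pos hζ hζ]

lemma key2 (β : ℝ) (hβ : -1 < β) (hβ1 : β < 1) (ζ : ℂ) (hζ : 0 < ζ.re) :
    IntegrableOn (fun s : ℝ => ((s ^ β : ℝ) : ℂ) / ((s:ℂ) ^ 2 + ζ ^ 2)) (Ioi 0) ∧
    ∫ s in Ioi (0:ℝ), ((s ^ β : ℝ) : ℂ) / ((s:ℂ) ^ 2 + ζ ^ 2) =
      ζ ^ ((β:ℂ) - 1) * ((Real.pi / (2 * Real.cos (Real.pi * β / 2)) : ℝ) : ℂ) := by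
  have h0 : ζ ≠ 0 := by rintro rfl; simp at hζ
  obtain ⟨h1, h2⟩ := key1 ((β + 1) / 2) (by linarith) (by linarith) ζ hζ
  rw [← integrableOn_Ioi_comp_rpow_iff' _ (p := 2) (by norm_num)] at h1
  rw [← integral_comp_rpow_Ioi_of_pos (p := 2) (by norm_num)] at h2
  have e : ∀ s ∈ Ioi (0:ℝ), (s ^ ((2:ℝ) - 1)) • ((((s ^ (2:ℝ)) ^ ((β + 1) / 2 - 1) : ℝ) : ℂ) *
      (ζ / (((s ^ (2:ℝ) : ℝ) : ℂ) + ζ ^ 2))) =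
      ζ * (((s ^ β : ℝ) : ℂ) / ((s:ℂ) ^ 2 + ζ ^ 2)) := by
    intro s hs
    have hs : 0 < s := hs
    rw [← Real.rpow_mul hs.le, Complex.real_smul, ← mul_assoc, ← Complex.ofReal_mul,
      ← Real.rpow_add hs, show (2:ℝ) - 1 + 2 * ((β + 1) / 2 - 1) = β by ring, Real.rpow_two]
    push_cast
    ring
  have e2 : ∀ s ∈ Ioi (0:ℝ), (2 * s ^ ((2:ℝ) - 1)) • ((((s ^ (2:ℝ)) ^ ((β + 1) / 2 - 1) : ℝ) : ℂ) *
      (ζ / (((s ^ (2:ℝ) : ℝ) : ℂ) + ζ ^ 2))) =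
      (2 * ζ) * (((s ^ β : ℝ) : ℂ) / ((s:ℂ) ^ 2 + ζ ^ 2)) := by
    intro s hs
    rw [mul_smul, e s hs, Complex.real_smul]
    push_cast
    ring
  constructor
  · have := (integrableOn_congr_fun e measurableSet_Ioi).1 h1
    have := this.const_mul ζ⁻¹
    refine (integrable_congr ?_).1 this
    filter_upwards with s
    field_simp
  · rw [setIntegral_congr_fun measurableSet_Ioi e2, integral_const_mul] at h2
    have hs : Real.sin (Real.pi * ((β + 1) / 2)) = Real.cos (Real.pi * β / 2) := by
      rw [← Real.sin_add_pi_div_two]; ring_nf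
    rw [hs] at h2
    have h3 : (2 : ℂ) * (((β + 1) / 2 : ℝ) : ℂ) - 1 = ((β : ℂ) - 1) + 1 := by push_cast; ring
    rw [h3, Complex.cpow_add _ _ h0, Complex.cpow_one] at h2
    have h4 : (2 * ζ) ≠ 0 := by simpa using h0
    apply mul_left_cancel₀ h4
    rw [h2]
    rw [show Real.pi / Real.cos (Real.pi * β / 2) =
      2 * (Real.pi / (2 * Real.cos (Real.pi * β / 2))) by
        rw [mul_comm 2 (Real.cos _), ← div_div]; ring]
    push_cast
    ring

lemma key3 (α : ℝ) (hα : α ∈ Ioo (-2 : ℝ) 1) (hα' : α ≠ -1) (ζ η : ℂ) (hζ : 0 < ζ.re)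
    (hη : 0 < η.re) (hne : η ^ 2 - ζ ^ 2 ≠ 0) :
    IntegrableOn (fun s : ℝ => ((s ^ (2 + α) : ℝ) : ℂ) /
      (((s:ℂ) ^ 2 + ζ ^ 2) * ((s:ℂ) ^ 2 + η ^ 2))) (Ioi 0) ∧
    ∫ s in Ioi (0:ℝ), ((s ^ (2 + α) : ℝ) : ℂ) / (((s:ℂ) ^ 2 + ζ ^ 2) * ((s:ℂ) ^ 2 + η ^ 2)) =
      (η ^ ((1:ℂ) + α) - ζ ^ ((1:ℂ) + α)) / (η ^ 2 - ζ ^ 2) *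
        ((Real.pi / (2 * Real.cos (Real.pi * α / 2)) : ℝ) : ℂ) := by
  have hz : ζ ≠ 0 := by rintro rfl; simp at hζ
  have hn : η ≠ 0 := by rintro rfl; simp at hη
  rcases lt_or_gt_of_ne hα' with h | h
  · obtain ⟨a1, a2⟩ := key2 (2 + α) (by linarith [hα.1]) (by linarith) ζ hζ
    obtain ⟨b1, b2⟩ := key2 (2 + α) (by linarith [hα.1]) (by linarith) η hη
    have e : ∀ s ∈ Ioi (0:ℝ), (η ^ 2 - ζ ^ 2)⁻¹ * (((s ^ (2 + α) : ℝ) : ℂ) / ((s:ℂ) ^ 2 + ζ ^ 2) -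
        ((s ^ (2 + α) : ℝ) : ℂ) / ((s:ℂ) ^ 2 + η ^ 2)) =
        ((s ^ (2 + α) : ℝ) : ℂ) / (((s:ℂ) ^ 2 + ζ ^ 2) * ((s:ℂ) ^ 2 + η ^ 2)) := by
      intro s hs
      have h1 := add_sq_ne ζ hζ s hs
      have h2 := add_sq_ne η hη s hs
      field_simp
      ring
    constructor
    · exact (integrableOn_congr_fun e measurableSet_Ioi).1 ((a1.sub b1).const_mul _)
    · rw [← setIntegral_congr_fun measurableSet_Ioi e, integral_const_mul, integral_sub a1 b1, a2, b2]
      rw [show Real.pi * (2 + α) / 2 = Real.pi * α / 2 + Real.pi by ring, Real.cos_add_pi]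
      rw [show (((2 + α : ℝ) : ℂ) - 1) = 1 + α by push_cast; ring]
      rw [mul_neg, div_neg]
      push_cast
      ring
  · obtain ⟨a1, a2⟩ := key2 α h hα.2 ζ hζ
    obtain ⟨b1, b2⟩ := key2 α h hα.2 η hη
    have e : ∀ s ∈ Ioi (0:ℝ), (η ^ 2 - ζ ^ 2)⁻¹ *
        (η ^ 2 * (((s ^ α : ℝ) : ℂ) / ((s:ℂ) ^ 2 + η ^ 2)) -
          ζ ^ 2 * (((s ^ α : ℝ) : ℂ) / ((s:ℂ) ^ 2 + ζ ^ 2))) =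
        ((s ^ (2 + α) : ℝ) : ℂ) / (((s:ℂ) ^ 2 + ζ ^ 2) * ((s:ℂ) ^ 2 + η ^ 2)) := by
      intro s hs
      have h1 := add_sq_ne ζ hζ s hs
      have h2 := add_sq_ne η hη s hs
      rw [Real.rpow_add hs, Real.rpow_two]
      push_cast
      field_simp
      ring
    constructor
    · exact (integrableOn_congr_fun e measurableSet_Ioi).1
        (((b1.const_mul _).sub (a1.const_mul _)).const_mul _)
    · rw [← setIntegral_congr_fun measurableSet_Ioi e, integral_const_mul,
        integral_sub (b1.const_mul _) (a1.const_mul _), integral_const_mul, integral_const_mul, a2, b2]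
      have hp : ∀ z : ℂ, z ≠ 0 → z ^ ((1:ℂ) + α) = z ^ 2 * z ^ ((α:ℂ) - 1) := by
        intro z hz
        rw [← Complex.cpow_two, ← Complex.cpow_add _ _ hz]
        ring_nf
      rw [hp _ hz, hp _ hn]
      ring

lemma rot (α t x : ℝ) (ht : 0 < t) (hx : 0 < x) :
    ((x:ℂ) - Complex.I * t) ^ ((1:ℂ) + α) = -Complex.I *
      (Real.cos (Real.pi * α / 2) - Complex.I * Real.sin (Real.pi * α / 2)) *
      ((t:ℂ) + Complex.I * x) ^ ((1:ℂ) + α) := by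
  have hw : ((t:ℂ) + Complex.I * x) ≠ 0 := by
    intro h
    have := congrArg Complex.re h
    simp at this
    linarith
  have e : (x:ℂ) - Complex.I * t = -Complex.I * ((t:ℂ) + Complex.I * x) := by
    ring_nf
    rw [Complex.I_sq]; ring
  have hl : Complex.log (-Complex.I * ((t:ℂ) + Complex.I * x)) =
      Complex.log (-Complex.I) + Complex.log ((t:ℂ) + Complex.I * x) := by
    rw [Complex.log_mul_eq_add_log_iff (by simp) hw, Complex.arg_neg_I]
    have h1 : |Complex.arg ((t:ℂ) + Complex.I * x)| < Real.pi / 2 := by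
      rw [Complex.abs_arg_lt_pi_div_two_iff]
      left
      simpa using ht
    rw [abs_lt] at h1
    have := Real.pi_pos
    have h2 : 0 ≤ Complex.arg ((t:ℂ) + Complex.I * x) := by
      rw [Complex.arg_nonneg_iff]; simpa using hx.le
    constructor <;> linarith
  rw [e, Complex.cpow_def_of_ne_zero (mul_ne_zero (by simp) hw), hl, add_mul, Complex.exp_add,
    ← Complex.cpow_def_of_ne_zero hw, Complex.log_neg_I]
  congr 1
  rw [show -(Real.pi / 2 : ℂ) * Complex.I * (1 + α) =
    -(Real.pi / 2 : ℂ) * Complex.I + ((-(Real.pi * α / 2) : ℝ) : ℂ) * Complex.I by push_cast; ring,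
    Complex.exp_add, Complex.exp_mul_I ((-(Real.pi * α / 2) : ℝ) : ℂ),
    ← Complex.ofReal_cos, ← Complex.ofReal_sin, Real.cos_neg, Real.sin_neg,
    ← Complex.log_neg_I, Complex.exp_log (by simp)]
  push_cast
  ring



/-- the integral identity
`(1/π)∫₀^∞ s^{2+α}/((4x²t² + (x²-t²+s²)²)(s²+y²)) ds
  = -(1/(2cos(πα/2))) y^{1+α}/(4x²t² + (x²-t²-y²)²)
    + (1/(4xt)) Re((1-ik)(t+ix)^{1+α}/((t+ix)²+y²))`,
with `k = tan(πα/2)`; the integral converges absolutely. -/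
theorem quadrant_integral_identity
    (α : ℝ) (hα : α ∈ Ioo (-2 : ℝ) 1) (hα' : α ≠ -1)
    (k : ℝ) (hk : k = Real.tan (Real.pi * α / 2))
    (t x y : ℝ) (ht : 0 < t) (hx : 0 < x) (hy : 0 < y) :
    IntegrableOn
      (fun s : ℝ => s ^ (2 + α) /
        ((4 * x ^ 2 * t ^ 2 + (x ^ 2 - t ^ 2 + s ^ 2) ^ 2) * (s ^ 2 + y ^ 2)))
      (Ioi 0) volume ∧
    (1 / Real.pi) * ∫ s in Ioi (0 : ℝ), s ^ (2 + α) /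
        ((4 * x ^ 2 * t ^ 2 + (x ^ 2 - t ^ 2 + s ^ 2) ^ 2) * (s ^ 2 + y ^ 2))
      = -(1 / (2 * Real.cos (Real.pi * α / 2))) *
          (y ^ (1 + α) / (4 * x ^ 2 * t ^ 2 + (x ^ 2 - t ^ 2 - y ^ 2) ^ 2))
        + (1 / (4 * x * t)) *
          (((1 - Complex.I * k) * ((t : ℂ) + Complex.I * x) ^ ((1 : ℂ) + α) /
              (((t : ℂ) + Complex.I * x) ^ 2 + (y : ℂ) ^ 2)).re) := by
  set w : ℂ := (t : ℂ) + Complex.I * x with hw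
  have hζ2 : ((x:ℂ) - Complex.I * t) ^ 2 = -w ^ 2 := by
    rw [hw]; ring_nf; rw [Complex.I_sq]; ring
  have hwr : (w ^ 2).re = t ^ 2 - x ^ 2 := by simp [hw, pow_two]
  have hwi : (w ^ 2).im = 2 * x * t := by simp [hw, pow_two]; ring
  have hxt : 0 < x * t := mul_pos hx ht
  have hne0 : w ^ 2 + (y:ℂ) ^ 2 ≠ 0 := by
    intro h
    have := congrArg Complex.im h
    rw [Complex.add_im, hwi, ← Complex.ofReal_pow, Complex.ofReal_im] at this
    simp at this
    rcases this with h | h <;> linarith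
  have hsub : (y:ℂ) ^ 2 - ((x:ℂ) - Complex.I * t) ^ 2 = w ^ 2 + (y:ℂ) ^ 2 := by
    rw [hζ2]; ring
  obtain ⟨h1, h2⟩ := key3 α hα hα' ((x:ℂ) - Complex.I * t) y (by simpa using hx)
    (by simpa using hy) (by rw [hsub]; exact hne0)
  have e : ∀ s ∈ Ioi (0:ℝ), (1 / (2 * x * t)) * (((s ^ (2 + α) : ℝ) : ℂ) /
      (((s:ℂ) ^ 2 + ((x:ℂ) - Complex.I * t) ^ 2) * ((s:ℂ) ^ 2 + (y:ℂ) ^ 2))).im =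
      s ^ (2 + α) / ((4 * x ^ 2 * t ^ 2 + (x ^ 2 - t ^ 2 + s ^ 2) ^ 2) * (s ^ 2 + y ^ 2)) := by
    intro s hs
    have hs : 0 < s := hs
    have q : ((s ^ (2 + α) : ℝ) : ℂ) /
      (((s:ℂ) ^ 2 + ((x:ℂ) - Complex.I * t) ^ 2) * ((s:ℂ) ^ 2 + (y:ℂ) ^ 2)) =
      ((s ^ (2 + α) / (s ^ 2 + y ^ 2) : ℝ) : ℂ) * ((s:ℂ) ^ 2 - w ^ 2)⁻¹ := by
      rw [hζ2]; push_cast; rw [← sub_eq_add_neg, mul_comm (_ - _), ← div_div, div_eq_mul_inv]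
    have r1 : ((s:ℂ) ^ 2 - w ^ 2).re = x ^ 2 - t ^ 2 + s ^ 2 := by
      rw [Complex.sub_re, hwr, ← Complex.ofReal_pow, Complex.ofReal_re]; ring
    have r2 : ((s:ℂ) ^ 2 - w ^ 2).im = - (2 * x * t) := by
      rw [Complex.sub_im, hwi, ← Complex.ofReal_pow, Complex.ofReal_im]; ring
    rw [q, Complex.im_ofReal_mul, Complex.inv_im, Complex.normSq_apply, r1, r2]
    have : (x ^ 2 - t ^ 2 + s ^ 2) * (x ^ 2 - t ^ 2 + s ^ 2) + -(2 * x * t) * -(2 * x * t) =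
      4 * x ^ 2 * t ^ 2 + (x ^ 2 - t ^ 2 + s ^ 2) ^ 2 := by ring
    rw [this]
    have : 0 < 4 * x ^ 2 * t ^ 2 + (x ^ 2 - t ^ 2 + s ^ 2) ^ 2 := by positivity
    field_simp
  have hcos : Real.cos (Real.pi * α / 2) ≠ 0 := by
    have hpi := Real.pi_pos
    rcases lt_or_gt_of_ne hα' with h | h
    · have : 0 < Real.cos (Real.pi * α / 2 + Real.pi) :=
        Real.cos_pos_of_mem_Ioo ⟨by nlinarith [hα.1], by nlinarith⟩
      rw [Real.cos_add_pi] at this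
      linarith
    · exact (Real.cos_pos_of_mem_Ioo ⟨by nlinarith, by nlinarith [hα.2]⟩).ne'
  have him : Integrable (fun s : ℝ => (((s ^ (2 + α) : ℝ) : ℂ) /
      (((s:ℂ) ^ 2 + ((x:ℂ) - Complex.I * t) ^ 2) * ((s:ℂ) ^ 2 + (y:ℂ) ^ 2))).im)
      (volume.restrict (Ioi (0:ℝ))) := h1.im
  constructor
  · exact (integrableOn_congr_fun e measurableSet_Ioi).1 (him.const_mul _)
  · have h3 : ∫ s in Ioi (0:ℝ), (((s ^ (2 + α) : ℝ) : ℂ) /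
      (((s:ℂ) ^ 2 + ((x:ℂ) - Complex.I * t) ^ 2) * ((s:ℂ) ^ 2 + (y:ℂ) ^ 2))).im = _ :=
      integral_im h1
    rw [← setIntegral_congr_fun measurableSet_Ioi e, integral_const_mul, h3, h2, hsub,
      rot α t x ht hx, ← hw]
    have hkc : Real.sin (Real.pi * α / 2) = k * Real.cos (Real.pi * α / 2) := by
      rw [hk, Real.tan_mul_cos hcos]
    rw [hkc]
    set c := Real.cos (Real.pi * α / 2) with hc
    have hcC : (c:ℂ) ≠ 0 := by exact_mod_cast hcos
    set Z := (1 - Complex.I * k) * w ^ ((1 : ℂ) + α) / (w ^ 2 + (y : ℂ) ^ 2) with hZ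
    have hyp : (y:ℂ) ^ ((1:ℂ) + α) = ((y ^ (1 + α) : ℝ) : ℂ) := by
      rw [Complex.ofReal_cpow hy.le]; push_cast; rfl
    have hfin : ((y:ℂ) ^ ((1:ℂ) + α) - -Complex.I * ((c:ℂ) - Complex.I * ((k * c : ℝ) : ℂ)) *
        w ^ ((1:ℂ) + α)) / (w ^ 2 + (y:ℂ) ^ 2) * ((Real.pi / (2 * c) : ℝ) : ℂ) =
        ((y ^ (1 + α) * (Real.pi / (2 * c)) : ℝ) : ℂ) * (w ^ 2 + (y:ℂ) ^ 2)⁻¹ +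
        ((Real.pi / 2 : ℝ) : ℂ) * (Complex.I * Z) := by
      rw [hyp, hZ]
      push_cast
      field_simp
      ring
    rw [hfin]
    have r1 : (w ^ 2 + (y:ℂ) ^ 2).re = t ^ 2 - x ^ 2 + y ^ 2 := by
      rw [Complex.add_re, hwr, ← Complex.ofReal_pow, Complex.ofReal_re]
    have r2 : (w ^ 2 + (y:ℂ) ^ 2).im = 2 * x * t := by
      rw [Complex.add_im, hwi, ← Complex.ofReal_pow, Complex.ofReal_im]; ring
    have him2 : ∀ z : ℂ, RCLike.im z = z.im := fun z => rfl
    rw [him2, Complex.add_im, Complex.im_ofReal_mul, Complex.im_ofReal_mul, Complex.inv_im,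
      Complex.normSq_apply, r1, r2, Complex.I_mul_im]
    have : (t ^ 2 - x ^ 2 + y ^ 2) * (t ^ 2 - x ^ 2 + y ^ 2) + (2 * x * t) * (2 * x * t) =
      4 * x ^ 2 * t ^ 2 + (x ^ 2 - t ^ 2 - y ^ 2) ^ 2 := by ring
    rw [this]
    have hD : 0 < 4 * x ^ 2 * t ^ 2 + (x ^ 2 - t ^ 2 - y ^ 2) ^ 2 := by positivity
    have hpi := Real.pi_pos
    field_simp
    ring
end
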